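/- A normal circular-arc (NCA) graph is a normal Helly circular-arc (NHCA) graph if and only if it contains no induced subgraph isomorphic to a wheel W_n (n ≥ 4), the 3-sun S_3, a rising sun R_n (n ≥ 4), the umbrella, or the tent. -/

import Mathlib

open Set

noncomputable section

instance : Fact ((0:ℝ) < 1) := ⟨one_pos⟩

/-- A point on the circle (of circumference 1). -/
abbrev Circ : Type := AddCircle (1 : ℝ)

/-- An arc of the circle, described by its beginning point `s` and its ending point `t`
(the arc is traversed clockwise, i.e. in the positive circular direction, from `s` to `t`). -/
structure Arc where
  s : Circ
  t : Circ

/-- The set of points of the open arc: the points strictly between `s` and `t`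
in the circular order. -/
def Arc.pts (A : Arc) : Set Circ := {x | sbtw A.s x A.t}

/-- The length of an arc: the representative in `(0, 1]` of `t - s`. -/
def Arc.length (A : Arc) : ℝ := ((AddCircle.equivIoc (1:ℝ) 0) (A.t - A.s) : ℝ)

/-- A circular-arc (CA) model: a finite family of arcs of the circle such that all
endpoints of the arcs are pairwise distinct (in particular each arc has two distinct
endpoints, hence no arc covers the whole circle). -/
structure CAModel (V : Type) [Fintype V] where
  arc : V → Arc
  endpoints_distinct : Function.Injective
    (fun p : V × Bool => if p.2 then (arc p.1).s else (arc p.1).t)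

namespace CAModel

variable {V : Type} [Fintype V]

/-- The arcs of `u` and `v` intersect. -/
def Inter (M : CAModel V) (u v : V) : Prop := ((M.arc u).pts ∩ (M.arc v).pts).Nonempty

/-- The intersection graph of the model: two distinct arcs are adjacent iff they have
nonempty intersection. -/
def interGraph (M : CAModel V) : SimpleGraph V :=
  SimpleGraph.fromRel fun u v => M.Inter u v

/-- `M` is a model of the graph `G`: the arcs are in correspondence with the vertices of `G`
and two vertices are adjacent iff their arcs are distinct and intersect. -/
def IsModelOf (M : CAModel V) (G : SimpleGraph V) : Prop :=
  ∀ u v, G.Adj u v ↔ u ≠ v ∧ M.Inter u v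

/-- Helly model: every subfamily of pairwise intersecting arcs has a common point. -/
def Helly (M : CAModel V) : Prop :=
  ∀ S : Set V, (∀ u ∈ S, ∀ v ∈ S, M.Inter u v) → ∃ p : Circ, ∀ v ∈ S, p ∈ (M.arc v).pts

/-- Normal model: no two arcs together cover the whole circle. -/
def Normal (M : CAModel V) : Prop :=
  ∀ u v : V, u ≠ v → (M.arc u).pts ∪ (M.arc v).pts ≠ Set.univ

/-- No three arcs together cover the whole circle. -/
def NoThreeCover (M : CAModel V) : Prop :=
  ∀ u v w : V, u ≠ v → u ≠ w → v ≠ w →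
    (M.arc u).pts ∪ (M.arc v).pts ∪ (M.arc w).pts ≠ Set.univ

/-- Proper model: no arc is properly contained in another arc. -/
def Proper (M : CAModel V) : Prop :=
  ∀ u v : V, u ≠ v → ¬ (M.arc u).pts ⊂ (M.arc v).pts

/-- Unit model: all arcs have the same length. -/
def IsUnit (M : CAModel V) : Prop :=
  ∀ u v : V, (M.arc u).length = (M.arc v).length

/-- Interval model: some point of the circle is covered by no arc. -/
def IsIntervalModel (M : CAModel V) : Prop :=
  ∃ p : Circ, ∀ v : V, p ∉ (M.arc v).pts

/-- A universal arc: it intersects every other arc of the model. -/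
def UniversalArc (M : CAModel V) (v : V) : Prop :=
  ∀ w, w ≠ v → M.Inter v w

end CAModel

section GraphClasses

variable {V : Type} [Fintype V]

def IsCAGraph (G : SimpleGraph V) : Prop := ∃ M : CAModel V, M.IsModelOf G
def IsHCAGraph (G : SimpleGraph V) : Prop := ∃ M : CAModel V, M.Helly ∧ M.IsModelOf G
def IsNCAGraph (G : SimpleGraph V) : Prop := ∃ M : CAModel V, M.Normal ∧ M.IsModelOf G
def IsNHCAGraph (G : SimpleGraph V) : Prop :=
  ∃ M : CAModel V, M.Normal ∧ M.Helly ∧ M.IsModelOf G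
def IsPCAGraph (G : SimpleGraph V) : Prop := ∃ M : CAModel V, M.Proper ∧ M.IsModelOf G
def IsNPCAGraph (G : SimpleGraph V) : Prop :=
  ∃ M : CAModel V, M.Normal ∧ M.Proper ∧ M.IsModelOf G
def IsPHCAGraph (G : SimpleGraph V) : Prop :=
  ∃ M : CAModel V, M.Proper ∧ M.Helly ∧ M.IsModelOf G
def IsUCAGraph (G : SimpleGraph V) : Prop := ∃ M : CAModel V, M.IsUnit ∧ M.IsModelOf G
def IsUHCAGraph (G : SimpleGraph V) : Prop :=
  ∃ M : CAModel V, M.IsUnit ∧ M.Helly ∧ M.IsModelOf G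
def IsIntervalGraph (G : SimpleGraph V) : Prop :=
  ∃ M : CAModel V, M.IsIntervalModel ∧ M.IsModelOf G

end GraphClasses
/-! ### Some small graphs -/

/-- The claw `K_{1,3}`: vertex `0` is adjacent to `1`, `2`, `3`, which are pairwise
non-adjacent. -/
def claw : SimpleGraph (Fin 4) := SimpleGraph.fromRel fun u _ => u = 0

/-- The `n`-wheel `W_n`: a chordless cycle on `n` vertices plus one extra vertex adjacent
to all of them (intended for `n ≥ 4`). -/
def wheel (n : ℕ) : SimpleGraph (Fin n ⊕ Unit) :=
  SimpleGraph.fromRel fun u v =>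
    (∃ x, u = Sum.inr x) ∨
    (∃ i j : Fin n, u = Sum.inl i ∧ v = Sum.inl j ∧ ((i : ℕ) + 1) % n = (j : ℕ))

/-- The 3-sun `S_3`: vertices `0,1,2` (the `v_i`'s) are pairwise adjacent, vertices
`3,4,5` (the `w_i`'s) are pairwise non-adjacent, and `w_i` is adjacent exactly to
`v_i` and `v_{i+1 (mod 3)}`. -/
def sun3 : SimpleGraph (Fin 6) :=
  SimpleGraph.fromRel fun u v =>
    ((u : ℕ) < 3 ∧ (v : ℕ) < 3) ∨
    (3 ≤ (u : ℕ) ∧ ((v : ℕ) = (u : ℕ) - 3 ∨ (v : ℕ) = ((u : ℕ) - 2) % 3))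

/-- The tent: the complement of the 3-sun. -/
def tent : SimpleGraph (Fin 6) := sun3ᶜ

/-- The `n`-rising sun `R_n` (intended for `n ≥ 4`): vertices `inl 0, …, inl (n-1)`
are `v_1, …, v_n` where `v_2, …, v_{n-1}` form a path in this order and `v_1`, `v_n`
are adjacent to all the `v`'s; `inr 0 = w_1` is adjacent exactly to `v_1, v_2`;
`inr 1 = w_{n-1}` is adjacent exactly to `v_{n-1}, v_n`; and `inr 2 = w_n` is adjacent
exactly to `v_n, v_1`. -/
def risingSun (n : ℕ) : SimpleGraph (Fin n ⊕ Fin 3) :=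
  SimpleGraph.fromRel fun u v =>
    match u, v with
    | Sum.inl a, Sum.inl b => (a : ℕ) = 0 ∨ (a : ℕ) = n - 1 ∨ (b : ℕ) = (a : ℕ) + 1
    | Sum.inr w, Sum.inl a =>
        ((w : ℕ) = 0 ∧ ((a : ℕ) = 0 ∨ (a : ℕ) = 1)) ∨
        ((w : ℕ) = 1 ∧ ((a : ℕ) = n - 2 ∨ (a : ℕ) = n - 1)) ∨
        ((w : ℕ) = 2 ∧ ((a : ℕ) = n - 1 ∨ (a : ℕ) = 0))
    | _, _ => False

/-- The umbrella: a path `0,1,2,3,4`, a vertex `5` adjacent to all of `0,…,4`, and a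
vertex `6` adjacent only to `2`. -/
def umbrella : SimpleGraph (Fin 7) :=
  SimpleGraph.fromRel fun u v =>
    ((u : ℕ) < 5 ∧ (v : ℕ) = (u : ℕ) + 1 ∧ (v : ℕ) < 5) ∨
    ((u : ℕ) = 5 ∧ (v : ℕ) < 5) ∨
    ((u : ℕ) = 6 ∧ (v : ℕ) = 2)

namespace NH
open Relation

section Abs
variable {V : Type} {G : SimpleGraph V}

def av (G : SimpleGraph V) (c v : V) : Prop := v ≠ c ∧ ¬ G.Adj v c

def Cn (G : SimpleGraph V) (P : V → Prop) (a b : V) : Prop :=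
  P a ∧ ReflTransGen (fun u v => G.Adj u v ∧ P v) a b

theorem av_comm {c v : V} : av G c v ↔ av G v c := by
  unfold av; rw [G.adj_comm]; constructor <;> rintro ⟨h, h'⟩ <;> exact ⟨h.symm, h'⟩

theorem av.symm {c v : V} (h : av G c v) : av G v c := av_comm.1 h

theorem not_av {c v : V} : ¬ av G c v ↔ v = c ∨ G.Adj v c := by
  unfold av; tauto

namespace Cn
variable {P Q : V → Prop} {a b c : V}

theorem left (h : Cn G P a b) : P a := h.1

theorem induct (h : Cn G P a b) {R : V → Prop} (h0 : R a)
    (hs : ∀ u v, Cn G P a u → R u → G.Adj u v → P v → R v) : R b := by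
  obtain ⟨ha, h⟩ := h
  induction h with
  | refl => exact h0
  | tail h1 h2 ih => exact hs _ _ ⟨ha, h1⟩ ih h2.1 h2.2

theorem right (h : Cn G P a b) : P b :=
  h.induct h.1 (fun _ _ _ _ _ h => h)

theorem refl (h : P a) : Cn G P a a := ⟨h, .refl⟩

theorem trans (h : Cn G P a b) (h' : Cn G P b c) : Cn G P a c := ⟨h.1, h.2.trans h'.2⟩

theorem tail (h : Cn G P a b) (h' : G.Adj b c) (hc : P c) : Cn G P a c :=
  ⟨h.1, h.2.tail ⟨h', hc⟩⟩

theorem single (h : G.Adj a b) (ha : P a) (hb : P b) : Cn G P a b := (refl ha).tail h hb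

theorem head (h' : G.Adj a b) (ha : P a) (h : Cn G P b c) : Cn G P a c :=
  (single h' ha h.left).trans h

theorem symm (h : Cn G P a b) : Cn G P b a :=
  h.induct (R := fun x => Cn G P x a) (refl h.1) (fun _ _ _ ih hv hp => head hv.symm hp ih)

theorem mono (h : Cn G P a b) (hPQ : ∀ z, P z → Q z) : Cn G Q a b :=
  h.induct (R := fun x => Cn G Q a x) (refl (hPQ _ h.1)) (fun _ _ _ ih hv hp => ih.tail hv (hPQ _ hp))

theorem upgrade (h : Cn G P a b) (hQ : ∀ z, Cn G P a z → Q z) : Cn G (fun z => P z ∧ Q z) a b :=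
  h.induct (R := fun x => Cn G (fun z => P z ∧ Q z) a x) (refl ⟨h.1, hQ _ (refl h.1)⟩)
    (fun _ _ h1 ih hv hp => ih.tail hv ⟨hp, hQ _ (h1.tail hv hp)⟩)

theorem hit (Q : V → Prop) (h : Cn G P a b) :
    Cn G (fun z => P z ∧ Q z) a b ∨ ∃ z, ¬ Q z ∧ Cn G P a z ∧ Cn G P z b := by
  by_contra hc
  push Not at hc
  apply hc.1
  have : ∀ x, Cn G P a x → Cn G P x b → Cn G (fun z => P z ∧ Q z) a x := by
    intro x hx
    have hQ : ∀ z, Cn G P a z → Q z := by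
      intro z hz
      by_contra hq
      exact hc.2 z hq hz (hz.symm.trans h)
    intro _
    exact hx.upgrade hQ
  exact this b h (refl h.right)

theorem last (Q : V → Prop) (h : Cn G P a b) (ha : Q a) (hb : ¬ Q b) :
    ∃ x y, P x ∧ Q x ∧ G.Adj x y ∧ Cn G (fun z => P z ∧ ¬ Q z) y b := by
  have := h.induct (R := fun b => Q b ∨ ∃ x y, P x ∧ Q x ∧ G.Adj x y ∧
    Cn G (fun z => P z ∧ ¬ Q z) y b) (Or.inl ha) (by
      intro u v hu ih huv hv
      by_cases hq : Q v
      · exact Or.inl hq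
      right
      rcases ih with h1 | ⟨x, y, h1, h2, h3, h4⟩
      · exact ⟨u, v, hu.right, h1, huv, refl ⟨hv, hq⟩⟩
      · exact ⟨x, y, h1, h2, h3, h4.tail huv ⟨hv, hq⟩⟩)
  tauto
end Cn

def HchOn (G : SimpleGraph V) (P : V → Prop) : Prop :=
  ∀ v x y u1 u2, P v → P x → P y → G.Adj v x → G.Adj v y → G.Adj x u1 → G.Adj y u2 →
    Cn G (fun z => P z ∧ av G v z) u1 u2 → x = y ∨ G.Adj x y

def Hch (G : SimpleGraph V) : Prop := HchOn G (fun _ => True)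

theorem Hch.use (h : Hch G) {v x y u1 u2 : V} (h1 : G.Adj v x) (h2 : G.Adj v y)
    (h3 : G.Adj x u1) (h4 : G.Adj y u2) (h5 : Cn G (av G v) u1 u2) : x = y ∨ G.Adj x y :=
  h v x y u1 u2 trivial trivial trivial h1 h2 h3 h4 (h5.mono fun _ h => ⟨trivial, h⟩)

theorem tri {P' P : V → Prop} (hH : HchOn G P') {u v w1 w2 : V} (huv : G.Adj u v)
    (h1 : G.Adj u w1) (h2 : G.Adj v w2) (hP : ∀ z, P z → P' z) (hu : P' u) (hv : P' v)
    (nu : ¬ P u) (nv : ¬ P v) (hC : Cn G P w1 w2) : ∃ t, P t ∧ G.Adj t u ∧ G.Adj t v := by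
  by_cases h3 : G.Adj w2 u
  · exact ⟨w2, hC.right, h3, h2.symm⟩
  obtain ⟨x, y, hx, hxu, hxy, hy⟩ := hC.last (fun z => G.Adj z u) h1.symm h3
  rcases hH u x v y w2 hu (hP _ hx) hv hxu.symm huv hxy h2 (hy.mono (by
    rintro z ⟨hz, hz'⟩
    refine ⟨hP _ hz, ?_, hz'⟩
    rintro rfl; exact nu hz)) with h | h
  · exact absurd (h ▸ hx) nv
  · exact ⟨x, hx, hxu, h⟩

theorem Hch.tri {P : V → Prop} (hH : Hch G) {u v w1 w2 : V} (huv : G.Adj u v)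
    (h1 : G.Adj u w1) (h2 : G.Adj v w2) 
    (nu : ¬ P u) (nv : ¬ P v) (hC : Cn G P w1 w2) : ∃ t, P t ∧ G.Adj t u ∧ G.Adj t v :=
  NH.tri hH huv h1 h2 (fun _ _ => trivial) trivial trivial nu nv hC

def IsAT (G : SimpleGraph V) (a b c : V) : Prop :=
  Cn G (av G c) a b ∧ Cn G (av G a) b c ∧ Cn G (av G b) c a

end Abs
end NH

namespace NH
open Relation

section Ord
set_option linter.unusedSectionVars false
open Classical
variable {V : Type} [Fintype V] {G : SimpleGraph V}

def RA (G : SimpleGraph V) (R : Finset V) (b z : V) : Prop := z ∈ R ∧ av G b z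

def Kp (G : SimpleGraph V) (R : Finset V) (s : V) : Prop := s ∉ R ∧ ∃ r ∈ R, G.Adj s r

def Rch (G : SimpleGraph V) (R : Finset V) (a b : V) : Prop :=
  ∃ u s, s ∉ R ∧ Cn G (RA G R b) a u ∧ G.Adj u s ∧ av G b s

def Inv (G : SimpleGraph V) (R : Finset V) : Prop :=
  (∀ s t, Kp G R s → Kp G R t → s ≠ t → G.Adj s t) ∧
  ∀ a ∈ R, ∀ b ∈ R, Rch G R a b → Rch G R b a → False

def Xp (G : SimpleGraph V) (R : Finset V) (x : V) : Prop := x ∈ R ∧ ∀ s, Kp G R s → G.Adj x s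

def Lt (G : SimpleGraph V) (R : Finset V) (b x : V) : Prop :=
  ∃ a, ¬ Xp G R a ∧ Cn G (RA G R b) x a

def X0 (G : SimpleGraph V) (R : Finset V) (x : V) : Prop :=
  Xp G R x ∧ ∀ y, Xp G R y → ¬ Lt G R y x

def Bet (G : SimpleGraph V) (R : Finset V) (a x b : V) : Prop :=
  Xp G R a ∧ Xp G R b ∧ Cn G (RA G R b) a x ∧ Cn G (RA G R a) b x

variable {R : Finset V}

theorem Cn.ra {b x y : V} (h : Cn G (RA G R b) x y) : Cn G (av G b) x y := h.mono fun _ h => h.2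

theorem exists_Xp (hH : Hch G) (hI : Inv G R) (hR : R.Nonempty) : ∃ x, Xp G R x := by
  obtain ⟨a, haR, hmax⟩ := R.exists_max_image
    (fun a => (Finset.univ.filter fun s => Kp G R s ∧ G.Adj a s).card) hR
  by_contra hno
  push Not at hno
  have := hno a
  simp only [Xp, not_and, not_forall] at this
  obtain ⟨k, hk, hak⟩ := this haR
  obtain ⟨hkR, b, hb, hkb⟩ := id hk
  have : ∃ k', Kp G R k' ∧ G.Adj a k' ∧ ¬ G.Adj b k' := by
    by_contra hc
    push Not at hc
    have h1 := hmax b hb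
    have h2 : (Finset.univ.filter fun s => Kp G R s ∧ G.Adj a s) ⊂
      (Finset.univ.filter fun s => Kp G R s ∧ G.Adj b s) := by
      rw [Finset.ssubset_iff_of_subset]
      · exact ⟨k, by simp [hk, hkb.symm], by simp [hak]⟩
      · intro s hs
        simp only [Finset.mem_filter, Finset.mem_univ, true_and] at hs ⊢
        exact ⟨hs.1, hc s hs.1 hs.2⟩
    have := Finset.card_lt_card h2
    omega
  obtain ⟨k', hk', hak', hbk'⟩ := this
  have hkk : k ≠ k' := by rintro rfl; exact hak hak'
  have hkk' := hI.1 k k' hk hk' hkk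
  have hab : a ≠ b := by rintro rfl; exact hbk' hak'
  have hka : av G a k := ⟨fun h => hkR (h ▸ haR), fun h => hak h.symm⟩
  have hkb' : av G b k' := ⟨fun h => hk'.1 (h ▸ hb), fun h => hbk' h.symm⟩
  by_cases h : G.Adj a b
  · rcases hH.use hak' h hkk'.symm hkb.symm (.refl hka) with h1 | h1
    · exact hk'.1 (h1 ▸ hb)
    · exact hbk' h1.symm
  · have hav : av G b a := ⟨hab, h⟩
    exact hI.2 a haR b hb ⟨a, k', hk'.1, .refl ⟨haR, hav⟩, hak', hkb'⟩
      ⟨b, k, hk.1, .refl ⟨hb, hav.symm⟩, hkb.symm, hka⟩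

theorem asym1 (hH : Hch G) (hAT : ∀ a b c, ¬ IsAT G a b c) {a b x k : V}
    (hb : Xp G R b) (hx : Xp G R x) (hxa : Cn G (RA G R b) x a) (hk : Kp G R k)
    (hak : ¬ G.Adj a k) : ∀ q, Cn G (RA G R x) b q → av G a q := by
  have hxk := hx.2 k hk
  have hbk := hb.2 k hk
  have haR : a ∈ R := hxa.right.1
  have hka : av G a k := ⟨fun h => hk.1 (h ▸ haR), fun h => hak h.symm⟩
  have h1 : ¬ Cn G (RA G R x) b a := by
    intro h
    apply hAT x b a
    refine ⟨?_, h.ra, hxa.ra.symm⟩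
    exact (Cn.single hxk h.right.2.symm hka).tail hbk.symm hxa.right.2.symm
  intro q hq
  by_contra hqa
  rw [not_av] at hqa
  rcases hqa with rfl | hqa
  · exact h1 hq
  have hax : a ≠ x := by rintro rfl; exact hak hxk
  have hax' : G.Adj a x := by
    by_contra h
    exact h1 (hq.tail hqa ⟨haR, hax, h⟩)
  have hc := hq.upgrade (Q := fun t => Cn G (RA G R x) b t) (fun _ h => h)
  have hc' : Cn G (fun t => (RA G R x t ∧ Cn G (RA G R x) b t) ∨ t = a) b a :=
    (hc.mono (fun _ h => Or.inl h)).tail hqa (Or.inr rfl)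
  obtain ⟨t, ht, htk, htx⟩ := hH.tri hxk.symm hbk.symm hax'.symm
    (by rintro (⟨h, _⟩ | h)
        · exact hk.1 h.1
        · exact hka.1 h)
    (by rintro (⟨h, _⟩ | h)
        · exact h.2.1 rfl
        · exact hax h.symm) hc'
  rcases ht with ht | rfl
  · exact ht.1.2.2 htx
  · exact hak htk

theorem not_Xp {a : V} (h : ¬ Xp G R a) (ha : a ∈ R) : ∃ k, Kp G R k ∧ ¬ G.Adj a k := by
  simp only [Xp, not_and, not_forall] at h
  obtain ⟨k, h1, h2⟩ := h ha
  exact ⟨k, h1, h2⟩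

theorem Lt.asym (hH : Hch G) (hAT : ∀ a b c, ¬ IsAT G a b c) (hI : Inv G R) {b x : V}
    (hb : Xp G R b) (hx : Xp G R x) (h1 : Lt G R b x) (h2 : Lt G R x b) : False := by
  obtain ⟨a, ha, hxa⟩ := h1
  obtain ⟨a', ha', hba⟩ := h2
  obtain ⟨k, hk, hak⟩ := not_Xp ha hxa.right.1
  obtain ⟨k', hk', hak'⟩ := not_Xp ha' hba.right.1
  have e1 := asym1 hH hAT hb hx hxa hk hak
  have e2 := asym1 hH hAT hx hb hba hk' hak'
  refine hI.2 a hxa.right.1 a' hba.right.1 ⟨x, k', hk'.1, ?_, hx.2 _ hk', ?_⟩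
    ⟨b, k, hk.1, ?_, hb.2 _ hk, ?_⟩
  · exact ((hxa.upgrade e2).mono fun z h => ⟨h.1.1, h.2⟩).symm
  · exact ⟨fun h => hk'.1 (h ▸ hba.right.1), fun h => hak' h.symm⟩
  · exact ((hba.upgrade e1).mono fun z h => ⟨h.1.1, h.2⟩).symm
  · exact ⟨fun h => hk.1 (h ▸ hxa.right.1), fun h => hak h.symm⟩

theorem Cn.from_near {P : V → Prop} {z y b : V} (hz : ¬ av G b z) (h : Cn G P z y) (hb : P b) :
    Cn G P b y := by
  rcases not_av.1 hz with rfl | h'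
  · exact h
  · exact h.head h'.symm hb

theorem Lt.tr (hH : Hch G) (hAT : ∀ a b c, ¬ IsAT G a b c) (hI : Inv G R) {b x y : V}
    (hb : Xp G R b) (hx : Xp G R x) (h1 : Lt G R b x) (h2 : Lt G R x y) : Lt G R b y := by
  obtain ⟨a', ha', hya⟩ := id h2
  rcases hya.hit (av G b) with h | ⟨z, hz, hz1, hz2⟩
  · exact ⟨a', ha', h.mono fun z h => ⟨h.1.1, h.2⟩⟩
  · exfalso
    refine Lt.asym hH hAT hI hb hx h1 ⟨a', ha', hz2.from_near hz ⟨hb.1, ?_⟩⟩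
    obtain ⟨a, _, h⟩ := h1
    exact h.left.2.symm

theorem exists_X0 (hH : Hch G) (hAT : ∀ a b c, ¬ IsAT G a b c) (hI : Inv G R)
    (hR : R.Nonempty) : ∃ x, X0 G R x := by
  obtain ⟨x, hx⟩ := exists_Xp hH hI hR
  let r : V → V → Prop := fun u v => Xp G R u ∧ Xp G R v ∧ Lt G R u v
  have i1 : IsTrans V r := ⟨fun a b c h1 h2 => ⟨h1.1, h2.2.1, Lt.tr hH hAT hI h1.1 h2.1 h1.2.2 h2.2.2⟩⟩
  have i2 : Std.Irrefl r := ⟨fun a h => Lt.asym hH hAT hI h.1 h.1 h.2.2 h.2.2⟩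
  have wf : WellFounded r := Finite.wellFounded_of_trans_of_irrefl r
  obtain ⟨m, hm, hmin⟩ := wf.has_min {x | Xp G R x} ⟨x, hx⟩
  exact ⟨m, hm, fun y hy h => hmin y hy ⟨hy, hm, h⟩⟩

theorem Bet.symm {a x b : V} (h : Bet G R a x b) : Bet G R b x a := ⟨h.2.1, h.1, h.2.2.2, h.2.2.1⟩

theorem Bet.X0 (hH : Hch G) (hAT : ∀ a b c, ¬ IsAT G a b c) {a x b : V} (hB : Bet G R a x b)
    (hx : X0 G R x) : X0 G R a := by
  obtain ⟨ha, hb, hP, hQ⟩ := hB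
  refine ⟨ha, fun y hy ⟨z, hz, hZ⟩ => ?_⟩
  rcases hP.hit (av G y) with h | ⟨p, hp, hp1, -⟩
  · refine hx.2 y hy ⟨z, hz, Cn.trans (h.mono fun w h => ⟨h.1.1, h.2⟩).symm hZ⟩
  rcases hZ.hit (av G b) with h | ⟨z1, hz1, hz2, hz3⟩
  · exact hx.2 b hb ⟨z, hz, hP.symm.trans (h.mono fun w h => ⟨h.1.1, h.2⟩)⟩
  by_cases hyb : av G y b
  · have hybZ := hz3.from_near hz1 ⟨hb.1, hyb⟩
    rcases hQ.hit (av G y) with h | ⟨w, hw, hw1, -⟩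
    · refine hx.2 y hy ⟨z, hz, Cn.trans (h.mono fun w h => ⟨h.1.1, h.2⟩).symm hybZ⟩
    apply hAT a b y
    refine ⟨(hz2.symm.ra.from_near hz1 hyb).symm, (hw1.symm.ra.from_near hw hZ.left.2.symm).symm,
      hp1.symm.ra.from_near hp hyb.symm⟩
  · rw [not_av] at hyb
    rcases hyb with rfl | hyb
    · exact hp hp1.right.2
    rw [not_av] at hp hz1
    have hpy : G.Adj p y := by
      rcases hp with rfl | hp
      · exact absurd hyb.symm hp1.right.2.2
      · exact hp
    have hzb : G.Adj z1 b := by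
      rcases hz1 with rfl | hp
      · exact absurd hyb hz2.right.2.2
      · exact hp
    obtain ⟨t, ht, h1, h2⟩ := hH.tri (P := fun t => av G b t ∨ av G y t) hyb.symm hpy.symm hzb.symm
      (by rintro (h | h)
          · exact h.2 hyb.symm
          · exact h.1 rfl)
      (by rintro (h | h)
          · exact h.1 rfl
          · exact h.2 hyb)
      ((hp1.symm.ra.mono fun _ h => Or.inl h).trans (hz2.ra.mono fun _ h => Or.inr h))
    rcases ht with h | h
    · exact h.2 h2
    · exact h.2 h1

def Cs (G : SimpleGraph V) (R : Finset V) (x v : V) : Finset V :=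
  Finset.univ.filter fun w => Cn G (RA G R x) v w

theorem mem_Cs {x v w : V} : w ∈ Cs G R x v ↔ Cn G (RA G R x) v w := by simp [Cs]

def Phi (G : SimpleGraph V) (R : Finset V) (x : V) : ℕ :=
  ∑ v ∈ R.filter (av G x), 4 ^ (Cs G R x v).card

theorem Bet.phi (hAT : ∀ a b c, ¬ IsAT G a b c) {a x b : V} (hB : Bet G R a x b)
    (hc : (Cs G R x a).card ≤ (Cs G R x b).card) : Phi G R x < Phi G R a := by
  obtain ⟨ha, hb, hP, hQ⟩ := hB
  have hxR := hP.right.1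
  have nab : ¬ Cn G (RA G R x) a b := fun h => hAT a b x ⟨h.ra, hQ.ra, hP.ra.symm⟩
  set S := R.filter (av G x) with hS
  set A := Cs G R x a with hA
  set B := Cs G R x b with hB
  have hax : RA G R x a := ⟨ha.1, hQ.right.2.symm⟩
  have hbx : RA G R x b := ⟨hb.1, hP.right.2.symm⟩
  have hAS : A ⊆ S := by
    intro v hv
    rw [hA, mem_Cs] at hv
    simpa [hS, RA] using hv.right
  have hBS : B ⊆ S \ A := by
    intro v hv
    rw [hB, mem_Cs] at hv
    rw [Finset.mem_sdiff]
    refine ⟨by simpa [hS, RA] using hv.right, ?_⟩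
    rw [hA, mem_Cs]
    intro h
    exact nab (h.trans hv.symm)
  have hav : ∀ v, RA G R x v → v ∉ A → av G a v := by
    intro v hv hvA
    by_contra h
    rw [hA, mem_Cs] at hvA
    rcases not_av.1 h with rfl | h
    · exact hvA (.refl hax)
    · exact hvA (.single h.symm hax hv)
  have hsub : ∀ v ∈ S \ A, Cs G R x v ⊆ Cs G R a v := by
    intro v hv w hw
    rw [mem_Cs] at hw ⊢
    refine (hw.upgrade (Q := av G a) ?_).mono fun _ h => ⟨h.1.1, h.2⟩
    intro z hz
    refine hav z hz.right fun hzA => ?_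
    rw [hA, mem_Cs] at hzA
    exact (Finset.mem_sdiff.1 hv).2 (mem_Cs.2 (hzA.trans hz.symm))
  have hBc : ∀ v ∈ B, (Cs G R x v).card = B.card := by
    intro v hv
    congr 1
    ext w
    rw [hB, mem_Cs] at hv
    rw [hB, mem_Cs, mem_Cs]
    exact ⟨fun h => hv.trans h, fun h => hv.symm.trans h⟩
  have hAc : ∀ v ∈ A, (Cs G R x v).card = A.card := by
    intro v hv
    congr 1
    ext w
    rw [hA, mem_Cs] at hv
    rw [hA, mem_Cs, mem_Cs]
    exact ⟨fun h => hv.trans h, fun h => hv.symm.trans h⟩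
  have hBa : ∀ v ∈ B, B.card + 1 ≤ (Cs G R a v).card := by
    intro v hv
    rw [← hBc v hv]
    have hs := hsub v (hBS hv)
    apply Nat.succ_le_of_lt
    apply Finset.card_lt_card
    rw [Finset.ssubset_iff_of_subset hs]
    refine ⟨x, ?_, ?_⟩
    · have hbv : b ∈ Cs G R a v := hs (mem_Cs.2 (mem_Cs.1 hv).symm)
      exact mem_Cs.2 ((mem_Cs.1 hbv).trans hQ)
    · intro h
      exact (mem_Cs.1 h).right.2.1 rfl
  have hB1 : 1 ≤ B.card := Finset.card_pos.2 ⟨b, mem_Cs.2 (.refl hbx)⟩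
  have e1 : Phi G R x = ∑ v ∈ (S \ A) \ B, 4 ^ (Cs G R x v).card + B.card * 4 ^ B.card
      + A.card * 4 ^ A.card := by
    unfold Phi
    rw [← hS, ← Finset.sum_sdiff hAS, ← Finset.sum_sdiff hBS]
    congr 1
    · congr 1
      rw [Finset.sum_congr rfl (fun v hv => by rw [hBc v hv])]
      simp
    · rw [Finset.sum_congr rfl (fun v hv => by rw [hAc v hv])]
      simp
  have e2 : ∑ v ∈ (S \ A) \ B, 4 ^ (Cs G R x v).card + B.card * 4 ^ (B.card + 1)
      ≤ ∑ v ∈ S \ A, 4 ^ (Cs G R a v).card := by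
    rw [← Finset.sum_sdiff hBS]
    apply add_le_add
    · apply Finset.sum_le_sum
      intro v hv
      exact Nat.pow_le_pow_right (by norm_num) (Finset.card_le_card (hsub v (Finset.mem_sdiff.1 hv).1))
    · have : ∑ v ∈ B, 4 ^ (B.card + 1) ≤ ∑ v ∈ B, 4 ^ (Cs G R a v).card := by
        apply Finset.sum_le_sum
        intro v hv
        exact Nat.pow_le_pow_right (by norm_num) (hBa v hv)
      simpa using this
  have e3 : ∑ v ∈ S \ A, 4 ^ (Cs G R a v).card ≤ Phi G R a := by
    unfold Phi
    apply Finset.sum_le_sum_of_subset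
    intro v hv
    have hv' := Finset.mem_sdiff.1 hv
    simp only [hS, Finset.mem_filter] at hv' ⊢
    exact ⟨hv'.1.1, hav v hv'.1 hv'.2⟩
  have e4 : A.card * 4 ^ A.card ≤ B.card * 4 ^ B.card :=
    Nat.mul_le_mul hc (Nat.pow_le_pow_right (by norm_num) hc)
  have e5 : 0 < B.card * 4 ^ B.card := by positivity
  have e6 : B.card * 4 ^ (B.card + 1) = 4 * (B.card * 4 ^ B.card) := by ring
  omega

theorem exists_noBet (hH : Hch G) (hAT : ∀ a b c, ¬ IsAT G a b c) (hI : Inv G R)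
    (hR : R.Nonempty) : ∃ x, X0 G R x ∧ ∀ a b, ¬ Bet G R a x b := by
  obtain ⟨x, hx⟩ := exists_X0 hH hAT hI hR
  obtain ⟨m, hm, hmax⟩ := (Finset.univ.filter (X0 G R)).exists_max_image (Phi G R) ⟨x, by simp [hx]⟩
  simp only [Finset.mem_filter, Finset.mem_univ, true_and] at hm hmax
  refine ⟨m, hm, fun a b hB => ?_⟩
  rcases le_total (Cs G R m a).card (Cs G R m b).card with h | h
  · have := hmax a (hB.X0 hH hAT hm)
    have := hB.phi hAT h
    omega
  · have := hmax b (hB.symm.X0 hH hAT hm)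
    have := hB.symm.phi hAT h
    omega

theorem Xp.not_Rch {a b : V} (hb : Xp G R b) : ¬ Rch G R a b := by
  rintro ⟨u, s, hs, hC, hus, hav⟩
  exact hav.2 (hb.2 s ⟨hs, u, hC.right.1, hus.symm⟩).symm

theorem Inv.erase (hI : Inv G R) {x : V} (hx : X0 G R x) (hB : ∀ a b, ¬ Bet G R a x b) :
    Inv G (R.erase x) := by
  have hK : ∀ s, Kp G (R.erase x) s → s = x ∨ Kp G R s := by
    rintro s ⟨hs, r, hr, hsr⟩
    by_cases h : s = x
    · exact Or.inl h
    · exact Or.inr ⟨fun h' => hs (Finset.mem_erase.2 ⟨h, h'⟩), r, (Finset.mem_erase.1 hr).2, hsr⟩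
  have hRc : ∀ a b, b ∈ R → Rch G (R.erase x) a b →
      Rch G R a b ∨ (Xp G R b ∧ Cn G (RA G R b) a x) := by
    rintro a b hb ⟨u, s, hs, hC, hus, hav⟩
    have hC' : Cn G (RA G R b) a u := hC.mono fun z hz => ⟨(Finset.mem_erase.1 hz.1).2, hz.2⟩
    by_cases h : s = x
    · subst h
      have hC2 := hC'.tail hus ⟨hx.1.1, hav⟩
      by_cases hbX : Xp G R b
      · exact Or.inr ⟨hbX, hC2⟩
      · obtain ⟨k, hk, hbk⟩ := not_Xp hbX hb
        exact Or.inl ⟨s, k, hk.1, hC2, hx.1.2 k hk, fun h => hk.1 (h ▸ hb), fun h => hbk h.symm⟩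
    · exact Or.inl ⟨u, s, fun h' => hs (Finset.mem_erase.2 ⟨h, h'⟩), hC', hus, hav⟩
  refine ⟨?_, ?_⟩
  · intro s t hs ht hst
    rcases hK s hs with rfl | hs'
    · rcases hK t ht with rfl | ht
      · exact absurd rfl hst
      · exact hx.1.2 t ht
    · rcases hK t ht with rfl | ht
      · exact (hx.1.2 s hs').symm
      · exact hI.1 s t hs' ht hst
  · intro a ha b hb h1 h2
    have ha := (Finset.mem_erase.1 ha).2
    have hb := (Finset.mem_erase.1 hb).2
    rcases hRc a b hb h1 with h1 | ⟨h1, h1'⟩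
    · rcases hRc b a ha h2 with h2 | ⟨h2, h2'⟩
      · exact hI.2 a ha b hb h1 h2
      · exact hx.2 a h2 ⟨b, fun h => h.not_Rch h1, h2'.symm⟩
    · rcases hRc b a ha h2 with h2 | ⟨h2, h2'⟩
      · exact hx.2 b h1 ⟨a, fun h => h.not_Rch h2, h1'.symm⟩
      · exact hB a b ⟨h2, h1, h1', h2'⟩

theorem ordering_aux (hH : Hch G) (hAT : ∀ a b c, ¬ IsAT G a b c) :
    ∀ n, ∀ R : Finset V, R.card = n → Inv G R → ∃ f : V → ℕ,
      (∀ u ∈ R, ∀ v ∈ R, f u = f v → u = v) ∧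
      (∀ u ∈ R, ∀ v ∈ R, ∀ w ∈ R, f u < f v → f v < f w → G.Adj u w → G.Adj u v) ∧
      (∀ s, s ∉ R → ∀ v ∈ R, ∀ w ∈ R, f v < f w → G.Adj s w → G.Adj s v) := by
  intro n
  induction n with
  | zero =>
    intro R hR _
    have : R = ∅ := Finset.card_eq_zero.1 hR
    subst this
    exact ⟨fun _ => 0, by simp⟩
  | succ n ih =>
    intro R hR hI
    have hne : R.Nonempty := Finset.card_pos.1 (by omega)
    obtain ⟨x, hx, hB⟩ := exists_noBet hH hAT hI hne
    obtain ⟨f, h1, h2, h3⟩ := ih (R.erase x) (by rw [Finset.card_erase_of_mem hx.1.1]; omega)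
      (hI.erase hx hB)
    have me : ∀ u ∈ R, u ≠ x → u ∈ R.erase x := fun u hu h => Finset.mem_erase.2 ⟨h, hu⟩
    refine ⟨fun v => if v = x then 0 else f v + 1, ?_, ?_, ?_⟩
    · intro u hu v hv h
      by_cases hux : u = x <;> by_cases hvx : v = x
      · rw [hux, hvx]
      · simp [hux, hvx] at h
      · simp [hux, hvx] at h
      · simp only [hux, hvx, if_false] at h
        exact h1 u (me u hu hux) v (me v hv hvx) (by omega)
    · intro u hu v hv w hw huv hvw hA
      have hvx : v ≠ x := by rintro rfl; simp at huv
      have hwx : w ≠ x := by rintro rfl; simp at hvw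
      simp only [hvx, hwx, if_false] at huv hvw
      by_cases hux : u = x
      · subst hux
        exact h3 u (by simp) v (me v hv hvx) w (me w hw hwx) (by omega) hA
      · simp only [hux, if_false] at huv
        exact h2 u (me u hu hux) v (me v hv hvx) w (me w hw hwx) (by omega) (by omega) hA
    · intro s hs v hv w hw hvw hA
      by_cases hvx : v = x
      · subst hvx
        exact (hx.1.2 s ⟨hs, w, hw, hA⟩).symm
      · have hwx : w ≠ x := by rintro rfl; simp at hvw
        simp only [hvx, hwx, if_false] at hvw
        exact h3 s (fun h => hs (Finset.mem_erase.1 h).2) v (me v hv hvx) w (me w hw hwx) (by omega) hA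

theorem ordering (hH : Hch G) (hAT : ∀ a b c, ¬ IsAT G a b c) :
    ∃ f : V → ℕ, Function.Injective f ∧
      ∀ u v w, f u < f v → f v < f w → G.Adj u w → G.Adj u v := by
  obtain ⟨f, h1, h2, -⟩ := ordering_aux hH hAT _ (Finset.univ : Finset V) rfl
    ⟨fun s t hs => absurd (Finset.mem_univ s) hs.1, fun a _ b _ ⟨u, s, hs, _⟩ => absurd (Finset.mem_univ s) hs⟩
  exact ⟨f, fun u v h => h1 u (Finset.mem_univ _) v (Finset.mem_univ _) h, fun u v w =>
    h2 u (Finset.mem_univ _) v (Finset.mem_univ _) w (Finset.mem_univ _)⟩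

end Ord
end NH

namespace NH

section Walks
variable {V : Type} {G : SimpleGraph V} {Q : V → Prop}

structure IsW (G : SimpleGraph V) (Q : V → Prop) (a b : V) (n : ℕ) (g : ℕ → V) : Prop where
  h0 : g 0 = a
  hn : g n = b
  adj : ∀ i < n, G.Adj (g i) (g (i + 1))
  mem : ∀ i ≤ n, Q (g i)

def HasW (G : SimpleGraph V) (Q : V → Prop) (a b : V) (n : ℕ) : Prop := ∃ g, IsW G Q a b n g

namespace IsW
variable {a b c : V} {n m : ℕ} {g : ℕ → V}

theorem sub (h : IsW G Q a b n g) {i j : ℕ} (hij : i ≤ j) (hj : j ≤ n) :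
    IsW G Q (g i) (g j) (j - i) (fun k => g (k + i)) := by
  refine ⟨by simp, by simp [hij], fun k hk => ?_, fun k hk => h.mem _ (by omega)⟩
  have := h.adj (k + i) (by omega)
  rwa [show k + i + 1 = k + 1 + i by omega] at this

theorem rev (h : IsW G Q a b n g) : IsW G Q b a n (fun k => g (n - k)) := by
  refine ⟨by simp [h.hn], by simp [h.h0], fun k hk => ?_, fun k hk => h.mem _ (by omega)⟩
  have := h.adj (n - (k+1)) (by omega)
  rw [show n - (k+1) + 1 = n - k by omega] at this
  exact this.symm

theorem cn (h : IsW G Q a b n g) {i j : ℕ} (hij : i ≤ j) (hj : j ≤ n) : Cn G Q (g i) (g j) := by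
  induction j, hij using Nat.le_induction with
  | base => exact .refl (h.mem _ hj)
  | succ j hij ih => exact (ih (by omega)).tail (h.adj j (by omega)) (h.mem _ hj)

end IsW

namespace HasW
variable {a b c : V} {n m : ℕ}

theorem single (hab : G.Adj a b) (ha : Q a) (hb : Q b) : HasW G Q a b 1 := by
  refine ⟨fun i => if i = 0 then a else b, by simp, by simp, ?_, ?_⟩
  · intro i hi
    have : i = 0 := by omega
    subst this
    simpa using hab
  · intro i _
    try dsimp only
    split_ifs <;> assumption

theorem refl (ha : Q a) : HasW G Q a a 0 := ⟨fun _ => a, rfl, rfl, by simp, fun _ _ => ha⟩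

theorem trans (h1 : HasW G Q a b n) (h2 : HasW G Q b c m) : HasW G Q a c (n + m) := by
  obtain ⟨g, hg⟩ := h1
  obtain ⟨f, hf⟩ := h2
  refine ⟨fun i => if i ≤ n then g i else f (i - n), by simp [hg.h0], ?_, ?_, ?_⟩
  · try dsimp only
    split_ifs with h
    · have : m = 0 := by omega
      subst this
      rw [← hf.hn, hf.h0, ← hg.hn]; rfl
    · rw [← hf.hn]; congr 1; omega
  · intro i hi
    try dsimp only
    by_cases h : i + 1 ≤ n
    · rw [if_pos (by omega), if_pos h]; exact hg.adj i (by omega)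
    · rw [if_neg h]
      split_ifs with h'
      · have : i = n := by omega
        subst this
        rw [hg.hn, ← hf.h0, show i + 1 - i = 0 + 1 by omega]
        exact hf.adj 0 (by omega)
      · rw [show i + 1 - n = i - n + 1 by omega]
        exact hf.adj _ (by omega)
  · intro i hi
    try dsimp only
    split_ifs with h
    · exact hg.mem _ h
    · exact hf.mem _ (by omega)

theorem rev (h : HasW G Q a b n) : HasW G Q b a n := by
  obtain ⟨g, hg⟩ := h
  exact ⟨_, hg.rev⟩

theorem of_cn (h : Cn G Q a b) : ∃ n, HasW G Q a b n :=
  h.induct (R := fun b => ∃ n, HasW G Q a b n) ⟨0, refl h.left⟩ (by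
    rintro u v hu ⟨n, hn⟩ huv hv
    exact ⟨n + 1, hn.trans (single huv hu.right hv)⟩)

end HasW

namespace IsW
variable {a b c : V} {n m : ℕ} {g : ℕ → V}

theorem has (h : IsW G Q a b n g) : HasW G Q a b n := ⟨g, h⟩

theorem pre (h : IsW G Q a b n g) {i : ℕ} (hi : i ≤ n) : HasW G Q a (g i) i := by
  have := h.sub (Nat.zero_le i) hi
  rw [h.h0] at this
  exact ⟨_, this⟩

theorem suf (h : IsW G Q a b n g) {i : ℕ} (hi : i ≤ n) : HasW G Q (g i) b (n - i) := by
  have := h.sub hi le_rfl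
  rw [h.hn] at this
  exact ⟨_, this⟩

theorem short_adj (h : IsW G Q a b n g) {i j : ℕ} (hij : i ≤ j) (hj : j ≤ n)
    (hA : G.Adj (g i) (g j)) : HasW G Q a b (i + 1 + (n - j)) :=
  ((h.pre (by omega)).trans (.single hA (h.mem _ (by omega)) (h.mem _ hj))).trans (h.suf hj)

theorem short_eq (h : IsW G Q a b n g) {i j : ℕ} (hij : i ≤ j) (hj : j ≤ n)
    (hA : g i = g j) : HasW G Q a b (i + (n - j)) :=
  (h.pre (by omega)).trans (hA ▸ h.suf hj)

/-- shortest walks are induced -/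
theorem ind (h : IsW G Q a b n g) (hmin : ∀ m, HasW G Q a b m → n ≤ m) {i j : ℕ} (hij : i ≤ j)
    (hj : j ≤ n) : G.Adj (g i) (g j) ↔ j = i + 1 := by
  constructor
  · intro hA
    have := hmin _ (h.short_adj hij hj hA)
    have : i ≠ j := by rintro rfl; exact G.loopless.irrefl _ hA
    omega
  · rintro rfl; exact h.adj i (by omega)

theorem inj (h : IsW G Q a b n g) (hmin : ∀ m, HasW G Q a b m → n ≤ m) {i j : ℕ} (hij : i ≤ j)
    (hj : j ≤ n) (he : g i = g j) : i = j := by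
  have := hmin _ (h.short_eq hij hj he)
  omega

theorem between (hH : Hch G) (h : IsW G Q a b n g) (hmin : ∀ m, HasW G Q a b m → n ≤ m) {v : V}
    (hv : ∀ i ≤ n, g i ≠ v) : ∀ d i j, j - i ≤ d → j ≤ n → G.Adj v (g i) → G.Adj v (g j) →
      ∀ t, i ≤ t → t ≤ j → G.Adj v (g t) := by
  intro d
  induction d with
  | zero => 
    intro i j h1 h2 h3 h4 t h5 h6
    have : t = i := by omega
    exact this ▸ h3
  | succ d ih =>
    intro i j h1 h2 h3 h4 t h5 h6
    rcases Nat.eq_or_lt_of_le h5 with rfl | h5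
    · exact h3
    rcases Nat.eq_or_lt_of_le h6 with rfl | h6
    · exact h4
    by_cases hs : ∃ s, i < s ∧ s < j ∧ G.Adj v (g s)
    · obtain ⟨s, hs1, hs2, hs3⟩ := hs
      rcases le_total t s with hts | hts
      · exact ih i s (by omega) (by omega) h3 hs3 t (by omega) hts
      · exact ih s j (by omega) (by omega) hs3 h4 t (by omega) (by omega)
    · exfalso
      push Not at hs
      have hC : Cn G (av G v) (g (i+1)) (g (j-1)) := by
        have : IsW G (fun z => ∃ s, i < s ∧ s < j ∧ g s = z) (g (i+1)) (g (j-1)) (j - 1 - (i+1))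
            (fun k => g (k + (i + 1))) := by
          have := h.sub (i := i+1) (j := j-1) (by omega) (by omega)
          exact ⟨this.h0, this.hn, this.adj, fun k hk => ⟨k+(i+1), by omega, by omega, rfl⟩⟩
        have h2 := this.cn (Nat.zero_le _) le_rfl
        rw [this.h0, this.hn] at h2
        refine h2.mono ?_
        rintro z ⟨s, hs1, hs2, rfl⟩
        exact ⟨hv s (by omega), fun h => hs s hs1 hs2 h.symm⟩
      have e1 := h.adj i (by omega)
      have e2 := h.adj (j-1) (by omega)
      rw [show j - 1 + 1 = j by omega] at e2
      rcases hH.use h3 h4 e1 e2.symm hC with h7 | h7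
      · have := h.inj hmin (by omega) h2 h7
        omega
      · have := (h.ind hmin (by omega) h2).1 h7
        omega

end IsW

theorem exists_min_W {a b : V} (h : Cn G Q a b) : ∃ n g, IsW G Q a b n g ∧
    ∀ m, HasW G Q a b m → n ≤ m := by
  classical
  have h := HasW.of_cn h
  obtain ⟨g, hg⟩ := Nat.find_spec h
  exact ⟨Nat.find h, g, hg, fun m hm => Nat.find_min' h hm⟩

end Walks
end NH

namespace NH

section Emb
variable {V : Type} {G : SimpleGraph V}

theorem emb_mk {W : Type} {H : SimpleGraph W} (f : W → V)
    (h : ∀ u v, u ≠ v → (H.Adj u v ∧ G.Adj (f u) (f v)) ∨ (¬ H.Adj u v ∧ av G (f u) (f v))) :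
    Nonempty (H ↪g G) := by
  have hinj : Function.Injective f := by
    intro u v huv
    by_contra hne
    rcases h u v hne with h | h
    · exact h.2.ne huv
    · exact h.2.1 huv.symm
  refine ⟨⟨⟨f, hinj⟩, ?_⟩⟩
  intro u v
  simp only [Function.Embedding.coeFn_mk]
  by_cases hne : u = v
  · subst hne; simp
  · rcases h u v hne with h | h
    · simp [h.1, h.2]
    · simp only [h.1, iff_false]; exact fun h' => h.2.2 h'.symm

theorem emb_fin {n : ℕ} {H : SimpleGraph (Fin n)} (f : Fin n → V)
    (h : ∀ u v, u < v → (H.Adj u v ∧ G.Adj (f u) (f v)) ∨ (¬ H.Adj u v ∧ av G (f u) (f v))) :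
    Nonempty (H ↪g G) := by
  refine emb_mk f fun u v huv => ?_
  rcases lt_or_gt_of_ne huv with h1 | h1
  · exact h u v h1
  · rcases h v u h1 with h2 | h2
    · exact Or.inl ⟨h2.1.symm, h2.2.symm⟩
    · exact Or.inr ⟨fun h => h2.1 h.symm, h2.2.symm⟩

theorem mk_sun3 {p q r a b c : V} (h1 : G.Adj p q) (h2 : G.Adj q r) (h3 : G.Adj r p)
    (h4 : G.Adj a r) (h5 : G.Adj a p) (h6 : G.Adj b p) (h7 : G.Adj b q) (h8 : G.Adj c q)
    (h9 : G.Adj c r) (e1 : av G a q) (e2 : av G b r) (e3 : av G c p)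
    (e4 : av G a b) (e5 : av G b c) (e6 : av G c a) : Nonempty (sun3 ↪g G) := by
  refine emb_fin ![r, p, q, a, b, c] ?_
  intro u v huv
  have := h1.symm; have := h2.symm; have := h3.symm; have := h4.symm; have := h5.symm
  have := h6.symm; have := h7.symm; have := h8.symm; have := h9.symm
  have := e1.symm; have := e2.symm; have := e3.symm; have := e4.symm; have := e5.symm
  have := e6.symm
  fin_cases u <;> fin_cases v <;> first | exact absurd huv (by decide) |
    (simp [sun3, SimpleGraph.fromRel_adj]; assumption)

theorem mk_tent {x y z a b c : V} (h1 : G.Adj x y) (h2 : G.Adj y z) (h3 : G.Adj z x)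
    (h4 : G.Adj x a) (h5 : G.Adj y b) (h6 : G.Adj z c) (e1 : av G x b) (e2 : av G x c)
    (e3 : av G y a) (e4 : av G y c) (e5 : av G z a) (e6 : av G z b)
    (e7 : av G a b) (e8 : av G b c) (e9 : av G c a) : Nonempty (tent ↪g G) := by
  refine emb_fin ![a, b, c, z, x, y] ?_
  intro u v huv
  have := h1.symm; have := h2.symm; have := h3.symm; have := h4.symm; have := h5.symm
  have := h6.symm
  have := e1.symm; have := e2.symm; have := e3.symm; have := e4.symm; have := e5.symm
  have := e6.symm; have := e7.symm; have := e8.symm; have := e9.symm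
  fin_cases u <;> fin_cases v <;> first | exact absurd huv (by decide) |
    (simp [tent, sun3, SimpleGraph.fromRel_adj, SimpleGraph.compl_adj]; assumption)

theorem mk_umbrella {v0 v1 v2 v3 v4 c u : V} (h1 : G.Adj v0 v1) (h2 : G.Adj v1 v2)
    (h3 : G.Adj v2 v3) (h4 : G.Adj v3 v4) (c0 : G.Adj c v0) (c1 : G.Adj c v1) (c2 : G.Adj c v2)
    (c3 : G.Adj c v3) (c4 : G.Adj c v4) (hu : G.Adj u v2) (u0 : av G u v0) (u1 : av G u v1)
    (u3 : av G u v3) (u4 : av G u v4) (uc : av G u c) (e1 : av G v0 v2) (e2 : av G v0 v3)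
    (e3 : av G v0 v4) (e4 : av G v1 v3) (e5 : av G v1 v4) (e6 : av G v2 v4) :
    Nonempty (umbrella ↪g G) := by
  refine emb_fin ![v0, v1, v2, v3, v4, c, u] ?_
  intro u v huv
  have := c0.symm; have := c1.symm; have := c2.symm; have := c3.symm; have := c4.symm
  have := hu.symm; have := u0.symm; have := u1.symm; have := u3.symm; have := u4.symm
  have := uc.symm
  fin_cases u <;> fin_cases v <;> first | exact absurd huv (by decide) |
    (simp [umbrella, SimpleGraph.fromRel_adj]; assumption)

theorem mk_rising {k : ℕ} {p : ℕ → V} {q r a b c : V} (hk : 2 ≤ k)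
    (hp : ∀ i j, 1 ≤ i → i < j → j ≤ k → (j = i + 1 ∧ G.Adj (p i) (p j)) ∨
      (j ≠ i + 1 ∧ av G (p i) (p j)))
    (hq : ∀ i, 1 ≤ i → i ≤ k → G.Adj (p i) q) (hr : ∀ i, 1 ≤ i → i ≤ k → G.Adj (p i) r)
    (hqr : G.Adj q r) (har : G.Adj a r) (hap : G.Adj a (p 1)) (hbp : G.Adj b (p k))
    (hbq : G.Adj b q) (hcq : G.Adj c q) (hcr : G.Adj c r)
    (ha : ∀ i, 2 ≤ i → i ≤ k → av G a (p i)) (hb : ∀ i, 1 ≤ i → i < k → av G b (p i))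
    (hc : ∀ i, 1 ≤ i → i ≤ k → av G c (p i)) (haq : av G a q) (hbr : av G b r)
    (e4 : av G a b) (e5 : av G b c) (e6 : av G c a) : Nonempty (risingSun (k + 2) ↪g G) := by
  let F : ℕ → V := fun i => if i = 0 then r else if i = k + 1 then q else p i
  have F0 : F 0 = r := by simp [F]
  have Fk : F (k+1) = q := by simp [F]
  have Fp : ∀ i, 1 ≤ i → i ≤ k → F i = p i := by
    intro i h1 h2
    simp only [F]
    rw [if_neg (by omega), if_neg (by omega)]
  let W : Fin 3 → V := ![a, b, c]
  let T := fun u v => ((risingSun (k+2)).Adj u v ∧ G.Adj (Sum.elim (fun i : Fin (k+2) => F i) W u) (Sum.elim (fun i : Fin (k+2) => F i) W v)) ∨ (¬ (risingSun (k+2)).Adj u v ∧ av G (Sum.elim (fun i : Fin (k+2) => F i) W u) (Sum.elim (fun i : Fin (k+2) => F i) W v))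
  have Tsymm : ∀ u v, T u v → T v u := by
    intro u v h
    rcases h with h2 | h2
    · exact Or.inl ⟨h2.1.symm, h2.2.symm⟩
    · exact Or.inr ⟨fun h => h2.1 h.symm, h2.2.symm⟩
  have T1 : ∀ i j : Fin (k+2), i < j → T (Sum.inl i) (Sum.inl j) := by
    intro i j hij
    have hij' : (i : ℕ) < j := hij
    have hj := j.2
    simp only [T, Sum.elim_inl, risingSun, SimpleGraph.fromRel_adj]
    have hne : i ≠ j := hij.ne
    simp only [ne_eq, Sum.inl.injEq, hne, not_false_eq_true, true_and]
    by_cases hi0 : (i : ℕ) = 0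
    · left
      refine ⟨by simp [hi0], ?_⟩
      rw [hi0, F0]
      by_cases hjk : (j : ℕ) = k + 1
      · rw [hjk, Fk]; exact hqr.symm
      · rw [Fp _ (by omega) (by omega)]; exact (hr _ (by omega) (by omega)).symm
    · rw [Fp i (by omega) (by omega)]
      by_cases hjk : (j : ℕ) = k + 1
      · left
        rw [hjk, Fk]
        exact ⟨by right; right; left; omega, hq _ (by omega) (by omega)⟩
      · rw [Fp j (by omega) (by omega)]
        rcases hp i j (by omega) hij' (by omega) with h | h
        · left; exact ⟨by left; right; right; exact h.1, h.2⟩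
        · right; exact ⟨by omega, h.2⟩
  have T2 : ∀ w (j : Fin (k+2)), T (Sum.inr w) (Sum.inl j) := by
    intro w j
    have hj := j.2
    simp only [T, Sum.elim_inl, Sum.elim_inr, risingSun, SimpleGraph.fromRel_adj]
    simp only [ne_eq, reduceCtorEq, not_false_eq_true, true_and, or_false]
    rcases Nat.eq_zero_or_pos (j : ℕ) with hj0 | hj0
    · rw [hj0, F0]
      fin_cases w
      · left; simp [W, har]
      · right; simp [W, hbr]; omega
      · left; simp [W, hcr]
    by_cases hjk : (j : ℕ) = k + 1
    · rw [hjk, Fk]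
      fin_cases w
      · right; simp [W, haq]; omega
      · left; simp [W, hbq]
      · left; simp [W, hcq]
    rw [Fp j hj0 (by omega)]
    have hjne : j ≠ 0 := by rintro rfl; simp at hj0
    fin_cases w
    · by_cases hj1 : (j : ℕ) = 1
      · left; simp [W, hj1, hap]
      · right; simp [W, hj1, hjne, ha j (by omega) (by omega)]
    · by_cases hj1 : (j : ℕ) = k
      · left; simp [W, hj1, hbp]
      · right; simp [W, hj1, hjne, hb j (by omega) (by omega)]; omega
    · right; simp [W, hjne, hc j (by omega) (by omega)]; omega
  refine emb_mk (Sum.elim (fun i : Fin (k+2) => F i) W) ?_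
  intro u v huv
  change T u v
  rcases u with i | w <;> rcases v with j | w'
  · rcases lt_trichotomy i j with h | h | h
    · exact T1 i j h
    · exact absurd (congrArg Sum.inl h) huv
    · exact Tsymm _ _ (T1 j i h)
  · exact Tsymm _ _ (T2 w' i)
  · exact T2 w j
  · simp only [T, Sum.elim_inr, risingSun, SimpleGraph.fromRel_adj]
    right
    simp only [or_false, and_false, not_false_eq_true, true_and]
    have := e4.symm; have := e5.symm; have := e6.symm
    fin_cases w <;> fin_cases w' <;> first | exact absurd rfl huv | (simp [W]; assumption)

end Emb
end NH

namespace NH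

section AT
variable {V : Type} {G : SimpleGraph V}

theorem IsW.cnr {Q Q' : V → Prop} {a b : V} {n : ℕ} {g : ℕ → V} (h : IsW G Q a b n g) {i j : ℕ}
    (hij : i ≤ j) (hj : j ≤ n) (hQ : ∀ s, i ≤ s → s ≤ j → Q' (g s)) : Cn G Q' (g i) (g j) := by
  induction j, hij using Nat.le_induction with
  | base => exact .refl (hQ _ le_rfl le_rfl)
  | succ j hij ih =>
    exact (ih (by omega) fun s h1 h2 => hQ s h1 (by omega)).tail (h.adj j (by omega))
      (hQ _ (by omega) le_rfl)

structure MAT (G : SimpleGraph V) (a b c : V) (k l m : ℕ) (p q r : ℕ → V) : Prop where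
  hp : IsW G (av G c) a b (k + 1) p
  hq : IsW G (av G a) b c (l + 1) q
  hr : IsW G (av G b) c a (m + 1) r
  min : ∀ a' b' c' n1 n2 n3, HasW G (av G c') a' b' n1 → HasW G (av G a') b' c' n2 →
    HasW G (av G b') c' a' n3 → k + l + m + 3 ≤ n1 + n2 + n3

def StarFree (G : SimpleGraph V) : Prop := ∀ y a b c,
  Cn G (fun z => av G b z ∧ av G c z) y a → Cn G (fun z => av G a z ∧ av G c z) y b →
  Cn G (fun z => av G a z ∧ av G b z) y c → False

def Bad (G : SimpleGraph V) : Prop :=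
  Nonempty (sun3 ↪g G) ∨ (∃ n, 4 ≤ n ∧ Nonempty (risingSun n ↪g G)) ∨
  Nonempty (umbrella ↪g G) ∨ Nonempty (tent ↪g G)

namespace MAT
variable {a b c : V} {k l m : ℕ} {p q r : ℕ → V}

theorem rot (h : MAT G a b c k l m p q r) : MAT G b c a l m k q r p :=
  ⟨h.hq, h.hr, h.hp, fun a' b' c' n1 n2 n3 h1 h2 h3 => by
    have := h.min c' a' b' n3 n1 n2 h3 h1 h2
    omega⟩

theorem refl (h : MAT G a b c k l m p q r) :
    MAT G b a c k m l (fun i => p (k + 1 - i)) (fun i => r (m + 1 - i)) (fun i => q (l + 1 - i)) :=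
  ⟨h.hp.rev, h.hr.rev, h.hq.rev, fun a' b' c' n1 n2 n3 h1 h2 h3 => by
    have := h.min b' a' c' n1 n3 n2 h1.rev h3.rev h2.rev
    omega⟩

theorem hab (h : MAT G a b c k l m p q r) : av G a b := by
  have := h.hq.mem 0 (by omega)
  rwa [h.hq.h0] at this

theorem hbc (h : MAT G a b c k l m p q r) : av G b c := h.rot.hab
theorem hca (h : MAT G a b c k l m p q r) : av G c a := h.rot.rot.hab

theorem k1 (h : MAT G a b c k l m p q r) : 1 ≤ k := by
  by_contra hk
  have : k = 0 := by omega
  subst this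
  have h1 := h.hp.adj 0 (by omega)
  rw [h.hp.h0, h.hp.hn] at h1
  exact h.hab.2 h1.symm

theorem pmin (h : MAT G a b c k l m p q r) : ∀ n, HasW G (av G c) a b n → k + 1 ≤ n := by
  intro n hn
  have := h.min a b c n _ _ hn h.hq.has h.hr.has
  omega

theorem a_p1 (h : MAT G a b c k l m p q r) : G.Adj a (p 1) := by
  have := h.hp.adj 0 (by omega)
  rwa [h.hp.h0] at this

theorem pk_b (h : MAT G a b c k l m p q r) : G.Adj (p k) b := by
  have := h.hp.adj k (by omega)
  rwa [h.hp.hn] at this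

theorem pc (h : MAT G a b c k l m p q r) {i : ℕ} (h2 : i ≤ k + 1) :
    av G c (p i) := h.hp.mem i h2

theorem pa (h : MAT G a b c k l m p q r) {i : ℕ} (h1 : 2 ≤ i) (h2 : i ≤ k + 1) :
    av G a (p i) := by
  constructor
  · intro h3
    have := h.hp.inj h.pmin (Nat.zero_le i) h2 (by rw [h.hp.h0, h3])
    omega
  · intro h3
    have := (h.hp.ind h.pmin (Nat.zero_le i) h2).1 (by rw [h.hp.h0]; exact h3.symm)
    omega

theorem pb (h : MAT G a b c k l m p q r) {i : ℕ} (h1 : i < k) :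
    av G b (p i) := by
  constructor
  · intro h3
    have := h.hp.inj h.pmin (show i ≤ k + 1 by omega) le_rfl (by rw [h.hp.hn, h3])
    omega
  · intro h3
    have := (h.hp.ind h.pmin (show i ≤ k + 1 by omega) le_rfl).1 (by rw [h.hp.hn]; exact h3)
    omega

theorem corner (h : MAT G a b c k l m p q r) (hH : Hch G) : p k = q 1 ∨ G.Adj (p k) (q 1) := by
  have hk := h.k1
  have hl := h.rot.k1
  have e1 := h.hp.adj (k-1) (by omega)
  rw [show k - 1 + 1 = k by omega] at e1
  refine hH.use h.pk_b.symm h.rot.a_p1 e1.symm (h.hq.adj 1 (by omega)) ?_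
  have c1 : Cn G (av G b) (p 0) (p (k-1)) := h.hp.cnr (by omega) (by omega) fun s _ h2 => h.pb (by omega)
  have c2 : Cn G (av G b) (q 2) (q (l+1)) := h.hq.cnr (by omega) (by omega) fun s h1 h2 => h.rot.pa h1 h2
  have c3 := h.hr.cn (Nat.zero_le _) le_rfl
  rw [h.hr.h0, h.hr.hn] at c3
  rw [h.hp.h0] at c1
  rw [h.hq.hn] at c2
  exact c1.symm.trans (c3.symm.trans c2.symm)

theorem sfact (h : MAT G a b c k l m p q r) (hS : StarFree G) {i : ℕ} (h1 : 1 < i) (h2 : i < k)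
    {x : V} (hx : G.Adj c x) (hxa : av G a x) (hxb : av G b x) : ¬ G.Adj (p i) x := by
  intro hix
  refine hS (p i) a b c ?_ ?_ ?_
  · have : Cn G (fun z => av G b z ∧ av G c z) (p 0) (p i) :=
      h.hp.cnr (by omega) (by omega) fun s _ h3 => ⟨h.pb (by omega), h.pc (by omega)⟩
    rw [h.hp.h0] at this
    exact this.symm
  · have : Cn G (fun z => av G a z ∧ av G c z) (p i) (p (k+1)) :=
      h.hp.cnr (by omega) (by omega) fun s _ h3 => ⟨h.pa (by omega) (by omega), h.pc (by omega)⟩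
    rwa [h.hp.hn] at this
  · exact (Cn.single hix ⟨h.pa (by omega) (by omega), h.pb (by omega)⟩ ⟨hxa, hxb⟩).tail hx.symm
      ⟨h.hca.symm, h.hbc⟩

theorem f1 (h : MAT G a b c k l m p q r) (hH : Hch G) (hS : StarFree G) (hk : 2 ≤ k) :
    G.Adj (p k) (r 1) ∨ G.Adj (p k) (r m) := by
  by_contra hc
  push Not at hc
  have hl := h.rot.k1
  have key : ∀ i ≤ m + 1, av G (p k) (r i) := by
    intro i hi
    rcases Nat.eq_zero_or_pos i with rfl | h0
    · rw [h.hr.h0]; exact (h.pc (by omega)).symm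
    rcases Nat.eq_or_lt_of_le hi with rfl | hi
    · rw [h.hr.hn]; exact (h.pa hk (by omega)).symm
    have hb := h.hr.mem i (by omega)
    refine ⟨fun h3 => hb.2 (h3 ▸ h.pk_b), fun h3 => ?_⟩
    by_cases h1 : i = 1
    · subst h1; exact hc.1 h3.symm
    by_cases h2 : i = m
    · subst h2; exact hc.2 h3.symm
    exact h.rot.rot.sfact hS (by omega) (by omega) h.pk_b.symm (h.pc (by omega)) (h.pa hk (by omega)) h3
  have w1 := h.hp.pre (i := k) (by omega)
  have w3 : HasW G (av G (p k)) c a (m + 1) := ⟨r, h.hr.h0, h.hr.hn, h.hr.adj, key⟩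
  have w2 := h.hq.suf (i := 1) (by omega)
  rcases h.corner hH with e | e
  · rw [← e] at w2
    have := h.min a (p k) c _ _ _ w1 w2 w3
    omega
  · have := h.min a (p k) c _ _ _ w1 ((HasW.single e (h.pa hk (by omega)) (h.hq.mem 1 (by omega))).trans w2) w3
    omega

theorem f1' (h : MAT G a b c k l m p q r) (hH : Hch G) (hS : StarFree G) (hk : 2 ≤ k) :
    G.Adj (p 1) (q l) ∨ G.Adj (p 1) (q 1) := by
  have := h.refl.f1 hH hS hk
  simpa using this

theorem n1 (h : MAT G a b c k l m p q r) (hH : Hch G) (hS : StarFree G) (hl : 2 ≤ l) (hm : 2 ≤ m)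
    (hA : G.Adj (q 1) (r m)) : Nonempty (tent ↪g G) := by
  have hq := h.rot
  have hr := h.rot.rot
  have hC : Cn G (fun t => (∃ j, 2 ≤ j ∧ j ≤ l ∧ t = q j) ∨ (∃ j, 1 ≤ j ∧ j < m ∧ t = r j))
      (q 2) (r (m-1)) := by
    have c1 : Cn G (fun t => (∃ j, 2 ≤ j ∧ j ≤ l ∧ t = q j) ∨ (∃ j, 1 ≤ j ∧ j < m ∧ t = r j))
        (q 2) (q l) := h.hq.cnr (by omega) (by omega) fun s h1 h2 => Or.inl ⟨s, h1, h2, rfl⟩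
    have c2 : Cn G (fun t => (∃ j, 2 ≤ j ∧ j ≤ l ∧ t = q j) ∨ (∃ j, 1 ≤ j ∧ j < m ∧ t = r j))
        (r 1) (r (m-1)) :=
      h.hr.cnr (by omega) (by omega) fun s h1 h2 => Or.inr ⟨s, h1, by omega, rfl⟩
    rcases hq.corner hH with e | e
    · rw [← e] at c2; exact c1.trans c2
    · exact (c1.tail e c2.left).trans c2
  have e2 := h.hr.adj (m-1) (by omega)
  rw [show m - 1 + 1 = m by omega] at e2
  obtain ⟨t, ht, t1, t2⟩ := hH.tri hA (h.hq.adj 1 (by omega)) e2.symm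
    (by rintro (⟨j, h1, h2, h3⟩ | ⟨j, h1, h2, h3⟩)
        · have := h.hq.inj hq.pmin (by omega) (by omega) h3
          omega
        · exact (h.hr.mem j (by omega)).2 (h3 ▸ hq.a_p1.symm))
    (by rintro (⟨j, h1, h2, h3⟩ | ⟨j, h1, h2, h3⟩)
        · exact (h.hq.mem j (by omega)).2 (h3 ▸ hr.pk_b)
        · have := h.hr.inj hr.pmin (by omega) (by omega) h3.symm
          omega) hC
  have f1 : av G c (q 1) := hq.pb (by omega)
  have f2 : av G a (q 1) := hq.pc (by omega)
  have f3 : av G c (r m) := hr.pa (by omega) (by omega)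
  have f4 : av G b (r m) := hr.pc (by omega)
  rcases ht with (⟨j, h1, h2, rfl⟩ | ⟨j, h1, h2, rfl⟩)
  · rcases Nat.eq_or_lt_of_le h2 with rfl | h2
    · exact mk_tent (x := r m) (y := q 1) (z := q j) (a := a) (b := b) (c := c) hA.symm t1.symm t2
        hr.pk_b hq.a_p1.symm hq.pk_b f4.symm f3.symm f2.symm f1.symm
        (hq.pc (by omega)).symm (hq.pa h1 (by omega)).symm h.hab h.hbc h.hca
    · exact absurd t2 (hq.sfact hS (by omega) h2 hr.pk_b.symm f4 f3)
  · by_cases hj : j = 1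
    · subst hj
      exact mk_tent (x := r m) (y := q 1) (z := r 1) (a := a) (b := b) (c := c) hA.symm t1.symm t2
        hr.pk_b hq.a_p1.symm hr.a_p1.symm f4.symm f3.symm f2.symm f1.symm
        (hr.pb (by omega)).symm (hr.pc (by omega)).symm h.hab h.hbc h.hca
    · exact absurd t1 (hr.sfact hS (by omega) h2 hq.a_p1 f1 f2)

theorem n2 (h : MAT G a b c k l m p q r) (hH : Hch G) (hS : StarFree G) (hk : 2 ≤ k) (hl : 2 ≤ l)
    (hm : 2 ≤ m) (hA : G.Adj (p k) (r m)) : Nonempty (tent ↪g G) := by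
  have hq := h.rot
  have hr := h.rot.rot
  by_cases hpq : p k = q 1
  · exact h.n1 hH hS hl hm (hpq ▸ hA)
  have hpq' : G.Adj (p k) (q 1) := (h.corner hH).resolve_left hpq
  have hC : Cn G (fun t => (∃ j, 1 ≤ j ∧ j ≤ l ∧ t = q j) ∨ (∃ j, 1 ≤ j ∧ j < m ∧ t = r j))
      (q 1) (r (m-1)) := by
    have c1 : Cn G (fun t => (∃ j, 1 ≤ j ∧ j ≤ l ∧ t = q j) ∨ (∃ j, 1 ≤ j ∧ j < m ∧ t = r j))
        (q 1) (q l) := h.hq.cnr (by omega) (by omega) fun s h1 h2 => Or.inl ⟨s, h1, h2, rfl⟩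
    have c2 : Cn G (fun t => (∃ j, 1 ≤ j ∧ j ≤ l ∧ t = q j) ∨ (∃ j, 1 ≤ j ∧ j < m ∧ t = r j))
        (r 1) (r (m-1)) :=
      h.hr.cnr (by omega) (by omega) fun s h1 h2 => Or.inr ⟨s, h1, by omega, rfl⟩
    rcases hq.corner hH with e | e
    · rw [← e] at c2; exact c1.trans c2
    · exact (c1.tail e c2.left).trans c2
  have e2 := h.hr.adj (m-1) (by omega)
  rw [show m - 1 + 1 = m by omega] at e2
  obtain ⟨t, ht, t1, t2⟩ := hH.tri hA hpq' e2.symm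
    (by rintro (⟨j, h1, h2, h3⟩ | ⟨j, h1, h2, h3⟩)
        · by_cases hj : j = 1
          · subst hj; exact hpq h3
          · exact (hq.pa (show 2 ≤ j by omega) (by omega)).2 (h3 ▸ h.pk_b)
        · exact (h.hr.mem j (by omega)).2 (h3 ▸ h.pk_b))
    (by rintro (⟨j, h1, h2, h3⟩ | ⟨j, h1, h2, h3⟩)
        · exact (h.hq.mem j (by omega)).2 (h3 ▸ hr.pk_b)
        · have := h.hr.inj hr.pmin (by omega) (by omega) h3.symm
          omega) hC
  have f1 : av G c (p k) := h.pc (by omega)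
  have f2 : av G a (p k) := h.pa hk (by omega)
  have f3 : av G c (r m) := hr.pa (by omega) (by omega)
  have f4 : av G b (r m) := hr.pc (by omega)
  rcases ht with (⟨j, h1, h2, rfl⟩ | ⟨j, h1, h2, rfl⟩)
  · by_cases hj : j = 1
    · subst hj
      exact h.n1 hH hS hl hm t2
    rcases Nat.eq_or_lt_of_le h2 with rfl | h2
    · exact mk_tent (x := r m) (y := p k) (z := q j) (a := a) (b := b) (c := c) hA.symm t1.symm t2
        hr.pk_b h.pk_b hq.pk_b f4.symm f3.symm f2.symm f1.symm
        (hq.pc (by omega)).symm (hq.pa (by omega) (by omega)).symm h.hab h.hbc h.hca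
    · exact absurd t2 (hq.sfact hS (by omega) h2 hr.pk_b.symm f4 f3)
  · by_cases hj : j = 1
    · subst hj
      exact mk_tent (x := r m) (y := p k) (z := r 1) (a := a) (b := b) (c := c) hA.symm t1.symm t2
        hr.pk_b h.pk_b hr.a_p1.symm f4.symm f3.symm f2.symm f1.symm
        (hr.pb (by omega)).symm (hr.pc (by omega)).symm h.hab h.hbc h.hca
    · exact absurd t1 (hr.sfact hS (by omega) h2 h.pk_b.symm f1 f2)

theorem case3 (h : MAT G a b c k l m p q r) (hH : Hch G) (hS : StarFree G) (hk : 2 ≤ k)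
    (hl : 2 ≤ l) (hm : 2 ≤ m) : Bad G := by
  refine Or.inr (Or.inr (Or.inr ?_))
  rcases h.f1 hH hS hk with h1 | h1
  · exact h.refl.rot.rot.n1 hH hS hk hm (by simpa using h1)
  · exact h.n2 hH hS hk hl hm h1

theorem case111 (h : MAT G a b c 1 1 1 p q r) (hH : Hch G) : Bad G := by
  left
  have hq := h.rot
  have hr := h.rot.rot
  have e1 : G.Adj (p 1) (q 1) := by
    refine (h.corner hH).resolve_left fun e => ?_
    exact (h.pc (i := 1) (by omega)).2 (e ▸ hq.pk_b)
  have e2 : G.Adj (q 1) (r 1) := by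
    refine (hq.corner hH).resolve_left fun e => ?_
    exact (hq.pc (i := 1) (by omega)).2 (e ▸ hr.pk_b)
  have e3 : G.Adj (r 1) (p 1) := by
    refine (hr.corner hH).resolve_left fun e => ?_
    exact (hr.pc (i := 1) (by omega)).2 (e ▸ h.pk_b)
  exact mk_sun3 e1 e2 e3 hr.pk_b.symm h.a_p1 h.pk_b.symm hq.a_p1 hq.pk_b.symm hr.a_p1
    (hq.pc (by omega)) (hr.pc (by omega)) (h.pc (by omega)) h.hab h.hbc h.hca

theorem casek11 (h : MAT G a b c k 1 1 p q r) (hH : Hch G) (hS : StarFree G) (hk : 2 ≤ k) :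
    Bad G := by
  have hq := h.rot
  have hr := h.rot.rot
  have e1 : G.Adj (p k) (q 1) := by
    refine (h.corner hH).resolve_left fun e => ?_
    exact (h.pc (i := k) (by omega)).2 (e ▸ hq.pk_b)
  have e2 : G.Adj (q 1) (r 1) := by
    refine (hq.corner hH).resolve_left fun e => ?_
    exact (hq.pc (i := 1) (by omega)).2 (e ▸ hr.pk_b)
  have e3 : G.Adj (r 1) (p 1) := by
    refine (hr.corner hH).resolve_left fun e => ?_
    exact (h.pc (i := 1) (by omega)).2 (e ▸ hr.a_p1.symm)
  have e4 : G.Adj (p k) (r 1) := by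
    have := h.f1 hH hS hk
    tauto
  have e5 : G.Adj (p 1) (q 1) := by
    have := h.f1' hH hS hk
    tauto
  have nq : ∀ i ≤ k + 1, p i ≠ q 1 := fun i hi e => (h.pc hi).2 (e ▸ hq.pk_b)
  have nr : ∀ i ≤ k + 1, p i ≠ r 1 := fun i hi e => (h.pc hi).2 (e ▸ hr.a_p1.symm)
  have aq : ∀ i, 1 ≤ i → i ≤ k → G.Adj (p i) (q 1) := fun i h1 h2 =>
    (h.hp.between hH h.pmin nq (k - 1) 1 k le_rfl (by omega) e5.symm e1.symm i h1 h2).symm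
  have ar : ∀ i, 1 ≤ i → i ≤ k → G.Adj (p i) (r 1) := fun i h1 h2 =>
    (h.hp.between hH h.pmin nr (k - 1) 1 k le_rfl (by omega) e3 e4.symm i h1 h2).symm
  refine Or.inr (Or.inl ⟨k + 2, by omega, ?_⟩)
  refine mk_rising hk (p := p) (q := q 1) (r := r 1) (a := a) (b := b) (c := c) ?_ aq ar e2
    hr.pk_b.symm h.a_p1 h.pk_b.symm hq.a_p1 hq.pk_b.symm hr.a_p1 ?_ ?_ ?_
    (hq.pc (by omega)) (hr.pc (by omega)) h.hab h.hbc h.hca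
  · intro i j h1 h2 h3
    by_cases hj : j = i + 1
    · left; exact ⟨hj, (h.hp.ind h.pmin (by omega) (by omega)).2 hj⟩
    · right
      refine ⟨hj, fun e => ?_, fun e => hj ?_⟩
      · have := h.hp.inj h.pmin (show i ≤ j by omega) (by omega) e.symm
        omega
      · exact (h.hp.ind h.pmin (by omega) (by omega)).1 e.symm
  · exact fun i h1 h2 => h.pa h1 (by omega)
  · exact fun i h1 h2 => h.pb h2
  · exact fun i h1 h2 => h.pc (by omega)

theorem casekl1 (h : MAT G a b c k l 1 p q r) (hH : Hch G) (hS : StarFree G) (hk : 2 ≤ k)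
    (hl : 2 ≤ l) : Bad G := by
  have hq := h.rot
  have hr := h.rot.rot
  have e1 : G.Adj (p k) (r 1) := by
    have := h.f1 hH hS hk
    tauto
  have e2 : G.Adj (q 1) (r 1) := by
    have := hq.f1' hH hS hl
    tauto
  have e3 : G.Adj (r 1) (p 1) := by
    refine (hr.corner hH).resolve_left fun e => ?_
    exact (h.pc (i := 1) (by omega)).2 (e ▸ hr.a_p1.symm)
  have e4 : G.Adj (q l) (r 1) := by
    refine (hq.corner hH).resolve_left fun e => ?_
    exact (hq.pc (i := l) (by omega)).2 (e ▸ hr.pk_b)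
  by_cases hpq : G.Adj (p 1) (q l)
  · exact Or.inr (Or.inr (Or.inr (hr.n1 hH hS hk hl hpq)))
  have e5 : G.Adj (p 1) (q 1) := (h.f1' hH hS hk).resolve_left hpq
  have e6 : G.Adj (q l) (p k) := (hq.f1 hH hS hl).resolve_left fun e => hpq e.symm
  have hq1b : G.Adj (q 1) b := hq.a_p1.symm
  have k2 : k = 2 := by
    have := h.pmin _ (((HasW.single h.a_p1 h.hca (h.pc (by omega))).trans
      (HasW.single e5 (h.pc (by omega)) (hq.pb (by omega)))).trans
      (HasW.single hq1b (hq.pb (by omega)) h.hbc.symm))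
    omega
  have l2 : l = 2 := by
    have := hq.pmin _ (((HasW.single h.pk_b.symm h.hab (h.pa (by omega) (by omega))).trans
      (HasW.single e6.symm (h.pa (by omega) (by omega)) (hq.pc (by omega)))).trans
      (HasW.single hq.pk_b (hq.pc (by omega)) h.hca.symm))
    omega
  subst k2 l2
  refine Or.inr (Or.inr (Or.inl ?_))
  refine mk_umbrella (v0 := a) (v1 := p 1) (v2 := q 1) (v3 := q 2) (v4 := c) (c := r 1) (u := b)
    h.a_p1 e5 (hq.hp.adj 1 (by omega)) hq.pk_b hr.pk_b e3 e2.symm e4.symm hr.a_p1.symm hq1b.symm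
    h.hab.symm (h.pb (by omega)) (hq.pa (by omega) (by omega)) h.hbc (hr.pc (by omega))
    (hq.pc (by omega)) (hq.pc (by omega)) h.hca.symm ⟨?_, fun e => hpq e.symm⟩
    (h.pc (by omega)).symm (hq.pb (by omega)).symm
  intro e
  exact (hq.pc (i := 2) (by omega)).2 (e ▸ h.a_p1.symm)

theorem bad (h : MAT G a b c k l m p q r) (hH : Hch G) (hS : StarFree G) : Bad G := by
  have hk := h.k1
  have hl := h.rot.k1
  have hm := h.rot.rot.k1
  by_cases k2 : k = 1 <;> by_cases l2 : l = 1 <;> by_cases m2 : m = 1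
  · subst k2 l2 m2; exact h.case111 hH
  · subst k2 l2; exact h.rot.rot.casek11 hH hS (by omega)
  · subst k2 m2; exact h.rot.casek11 hH hS (by omega)
  · subst k2; exact h.rot.casekl1 hH hS (by omega) (by omega)
  · subst l2 m2; exact h.casek11 hH hS (by omega)
  · subst l2; exact h.rot.rot.casekl1 hH hS (by omega) (by omega)
  · subst m2; exact h.casekl1 hH hS (by omega) (by omega)
  · exact h.case3 hH hS (by omega) (by omega) (by omega)

end MAT

theorem AT_bad (hH : Hch G) (hS : StarFree G) {a b c : V} (h : IsAT G a b c) : Bad G := by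
  classical
  have hex : ∃ n, ∃ a b c n1 n2 n3, HasW G (av G c) a b n1 ∧ HasW G (av G a) b c n2 ∧
      HasW G (av G b) c a n3 ∧ n = n1 + n2 + n3 := by
    obtain ⟨n1, h1⟩ := HasW.of_cn h.1
    obtain ⟨n2, h2⟩ := HasW.of_cn h.2.1
    obtain ⟨n3, h3⟩ := HasW.of_cn h.2.2
    exact ⟨_, a, b, c, n1, n2, n3, h1, h2, h3, rfl⟩
  obtain ⟨a, b, c, n1, n2, n3, h1, h2, h3, hn⟩ := Nat.find_spec hex
  have hmin : ∀ a' b' c' m1 m2 m3, HasW G (av G c') a' b' m1 → HasW G (av G a') b' c' m2 →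
    HasW G (av G b') c' a' m3 → n1 + n2 + n3 ≤ m1 + m2 + m3 := by
    intro a' b' c' m1 m2 m3 e1 e2 e3
    rw [← hn]
    exact Nat.find_min' hex ⟨a', b', c', m1, m2, m3, e1, e2, e3, rfl⟩
  obtain ⟨p, hp⟩ := h1
  obtain ⟨q, hq⟩ := h2
  obtain ⟨r, hr⟩ := h3
  have pos : ∀ {n : ℕ} {a b c : V} {g h : ℕ → V} {n' : ℕ}, IsW G (av G c) a b n g →
      IsW G (av G a) b c n' h → n ≠ 0 := by
    intro n a b c g h n' hg hh hn
    subst hn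
    have := hh.mem 0 (by omega)
    rw [hh.h0, ← hg.hn, ← hg.h0] at this
    exact this.1 rfl
  obtain ⟨k, rfl⟩ := Nat.exists_eq_succ_of_ne_zero (pos hp hq)
  obtain ⟨l, rfl⟩ := Nat.exists_eq_succ_of_ne_zero (pos hq hr)
  obtain ⟨m, rfl⟩ := Nat.exists_eq_succ_of_ne_zero (pos hr hp)
  have : MAT G a b c k l m p q r := ⟨hp, hq, hr, fun a' b' c' m1 m2 m3 e1 e2 e3 => by
    have := hmin a' b' c' m1 m2 m3 e1 e2 e3
    omega⟩
  exact this.bad hH hS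

end AT
end NH

namespace NH

section Geo

def ph (q x : Circ) : ℝ := (AddCircle.equivIco (1:ℝ) 0 (x - q) : ℝ)

theorem ph_nonneg (q x : Circ) : 0 ≤ ph q x := (AddCircle.equivIco (1:ℝ) 0 (x - q)).2.1
theorem ph_lt (q x : Circ) : ph q x < 1 := by
  have := (AddCircle.equivIco (1:ℝ) 0 (x - q)).2.2
  simpa [ph] using this

theorem ph_coe (q x : Circ) : ((ph q x : ℝ) : Circ) = x - q := AddCircle.coe_equivIco

theorem ph_inj (q : Circ) : Function.Injective (ph q) := by
  intro x y h
  have := congrArg (fun r : ℝ => (r : Circ)) h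
  simp only [ph_coe] at this
  exact sub_left_injective this

theorem ph_of {q : Circ} {y : ℝ} (h0 : 0 ≤ y) (h1 : y < 1) : ph q (q + (y : Circ)) = y := by
  unfold ph
  rw [add_sub_cancel_left]
  have := AddCircle.equivIco_coe_eq (p := (1:ℝ)) (a := 0) (x := y) ⟨h0, by simpa using h1⟩
  rw [this]

theorem ph_self (q : Circ) : ph q q = 0 := by
  have := ph_of (q := q) le_rfl (one_pos : (0:ℝ) < 1)
  simpa using this

theorem ph_pos {q x : Circ} (h : x ≠ q) : 0 < ph q x := by
  rcases (ph_nonneg q x).lt_or_eq with h1 | h1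
  · exact h1
  · exact absurd (ph_inj q (h1.symm.trans (ph_self q).symm)) h

theorem sbtw_iff (q a b c : Circ) : sbtw a b c ↔
    (ph q a < ph q b ∧ ph q b < ph q c) ∨ (ph q b < ph q c ∧ ph q c < ph q a) ∨
    (ph q c < ph q a ∧ ph q a < ph q b) := by
  obtain ⟨y, rfl⟩ := QuotientAddGroup.mk_surjective q
  change _ ↔ (ph (y : Circ) a < ph (y : Circ) b ∧ ph (y : Circ) b < ph (y : Circ) c) ∨
    (ph (y : Circ) b < ph (y : Circ) c ∧ ph (y : Circ) c < ph (y : Circ) a) ∨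
    (ph (y : Circ) c < ph (y : Circ) a ∧ ph (y : Circ) a < ph (y : Circ) b)
  have ha0 := ph_nonneg (y : Circ) a
  have hb0 := ph_nonneg (y : Circ) b
  have hc0 := ph_nonneg (y : Circ) c
  have ha1 := ph_lt (y : Circ) a
  have hb1 := ph_lt (y : Circ) b
  have hc1 := ph_lt (y : Circ) c
  have ha : a = ((ph (y:Circ) a + y : ℝ) : Circ) := by
    rw [AddCircle.coe_add, ph_coe]; simp
  have hb : b = ((ph (y:Circ) b + y : ℝ) : Circ) := by
    rw [AddCircle.coe_add, ph_coe]; simp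
  have hc : c = ((ph (y:Circ) c + y : ℝ) : Circ) := by
    rw [AddCircle.coe_add, ph_coe]; simp
  generalize ph (y:Circ) a = A at *
  generalize ph (y:Circ) b = B at *
  generalize ph (y:Circ) c = C at *
  subst ha hb hc
  rw [sbtw_iff_not_btw, QuotientAddGroup.btw_coe_iff, not_le]
  have e1 : toIocMod (one_pos : (0:ℝ) < 1) (C + y) (A + y) = if A ≤ C then A + y + 1 else A + y := by
    rw [toIocMod_eq_iff]
    split_ifs with h
    · exact ⟨⟨by linarith, by linarith⟩, -1, by simp⟩
    · exact ⟨⟨by linarith, by linarith⟩, 0, by simp⟩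
  have e2 : toIcoMod (one_pos : (0:ℝ) < 1) (C + y) (B + y) = if B < C then B + y + 1 else B + y := by
    rw [toIcoMod_eq_iff]
    split_ifs with h
    · exact ⟨⟨by linarith, by linarith⟩, -1, by simp⟩
    · exact ⟨⟨by linarith, by linarith⟩, 0, by simp⟩
  rw [e1, e2]
  split_ifs with h1 h2 h2
  · constructor
    · intro h; left; constructor <;> linarith
    · rintro (h | h | h) <;> linarith
  · constructor
    · intro h; exfalso; linarith
    · rintro (h | h | h) <;> linarith
  · constructor
    · intro h; right; left; constructor <;> linarith
    · intro h; linarith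
  · constructor
    · intro h; right; right; constructor <;> linarith
    · rintro (h | h | h) <;> linarith

theorem mem_pts (q x : Circ) (A : Arc) : x ∈ A.pts ↔
    (ph q A.s < ph q x ∧ ph q x < ph q A.t) ∨ (ph q x < ph q A.t ∧ ph q A.t < ph q A.s) ∨
    (ph q A.t < ph q A.s ∧ ph q A.s < ph q x) := sbtw_iff q _ _ _

/-- An arc not containing `q` is a plain interval in the coordinate `ph q`. -/
theorem mem_pts_of_not {q : Circ} {A : Arc} (hq : q ∉ A.pts) (x : Circ) : x ∈ A.pts ↔
    (ph q A.s < ph q x ∧ (ph q x < ph q A.t ∨ A.t = q)) ∧ A.s ≠ A.t := by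
  rw [mem_pts q] at hq ⊢
  rw [ph_self] at hq
  have h1 := ph_nonneg q A.s
  have h2 := ph_nonneg q A.t
  have h3 := ph_nonneg q x
  by_cases ht : A.t = q
  · have ht0 : ph q A.t = 0 := by rw [ht]; exact ph_self q
    by_cases hs : A.s = A.t
    · rw [hs, ht0]; simp [h3]
    · have : 0 < ph q A.s := ph_pos (ht ▸ hs)
      rw [ht0]
      simp only [ht, or_true, and_true]
      constructor
      · rintro (h | h | h)
        · linarith
        · linarith
        · exact ⟨h.2, ht ▸ hs⟩
      · intro h; right; right; exact ⟨this, h.1⟩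
  · have ht0 : 0 < ph q A.t := ph_pos ht
    have hle : ph q A.s ≤ ph q A.t := by
      by_contra h
      push Not at h
      exact hq (Or.inr (Or.inl ⟨ht0, h⟩))
    simp only [ht, or_false]
    constructor
    · rintro (h | h | h)
      · exact ⟨h, fun e => by rw [e] at h; linarith⟩
      · linarith
      · linarith
    · intro h; exact Or.inl h.1

theorem convex_of_not {q : Circ} {A : Arc} (hq : q ∉ A.pts) {x y z : Circ} (hx : x ∈ A.pts)
    (hz : z ∈ A.pts) (h1 : ph q x ≤ ph q y) (h2 : ph q y ≤ ph q z) : y ∈ A.pts := by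
  rw [mem_pts_of_not hq] at hx hz ⊢
  refine ⟨⟨by linarith [hx.1.1], ?_⟩, hx.2⟩
  rcases hz.1.2 with h | h
  · left; linarith
  · right; exact h

/-- General version: between two points, an arc contains one of the two sides. -/
theorem side {q : Circ} {A : Arc} {x z : Circ} (hx : x ∈ A.pts) (hz : z ∈ A.pts)
    (hxz : ph q x ≤ ph q z) : (∀ y, ph q x ≤ ph q y → ph q y ≤ ph q z → y ∈ A.pts) ∨
    (∀ y, (ph q y ≤ ph q x ∨ ph q z ≤ ph q y) → y ∈ A.pts) := by
  rw [mem_pts q] at hx hz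
  by_contra hc
  push Not at hc
  obtain ⟨⟨y, h1, h2, h3⟩, w, h4, h5⟩ := hc
  rw [mem_pts q] at h3 h5
  push Not at h3 h5
  obtain ⟨a1, a2, a3⟩ := h3
  obtain ⟨b1, b2, b3⟩ := h5
  rcases hx with ⟨x1, x2⟩ | ⟨x1, x2⟩ | ⟨x1, x2⟩ <;> rcases hz with ⟨z1, z2⟩ | ⟨z1, z2⟩ | ⟨z1, z2⟩ <;>
    rcases h4 with h4 | h4 <;> grind

/-- Lemma Two -/
theorem two {q : Circ} {D : Arc} {α γ x z : Circ} (hα : α ∉ D.pts) (hγ : γ ∉ D.pts)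
    (hαγ : ph q α < ph q γ) (hx : x ∈ D.pts) (hz : z ∈ D.pts)
    (h : ph q α < ph q x ∧ ph q x < ph q γ) : ph q α < ph q z ∧ ph q z < ph q γ := by
  by_contra hc
  rcases le_total (ph q x) (ph q z) with hxz | hxz
  · rcases side hx hz hxz with h' | h'
    · have : ph q γ ≤ ph q z := by by_contra h''; exact hc ⟨by linarith, by linarith⟩
      exact hγ (h' γ (by linarith) this)
    · exact hα (h' α (Or.inl (by linarith)))
  · rcases side hz hx hxz with h' | h'
    · have : ph q z ≤ ph q α := by by_contra h''; exact hc ⟨by linarith, by linarith⟩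
      exact hα (h' α this (by linarith))
    · exact hγ (h' γ (Or.inr (by linarith)))

theorem ne_of_mem {A : Arc} {x : Circ} (h : x ∈ A.pts) : A.s ≠ A.t := by
  intro e
  rw [mem_pts A.s, ← e] at h
  rcases h with h | h | h <;> linarith [h.1, h.2]

theorem pts_eq_image {A : Arc} (hA : A.s ≠ A.t) :
    A.pts = (fun y : ℝ => A.s + (y : Circ)) '' Ioo 0 (ph A.s A.t) := by
  have ht := ph_pos (Ne.symm hA)
  ext x
  rw [mem_pts A.s, ph_self]
  simp only [mem_image, mem_Ioo]
  have h1 := ph_lt A.s A.t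
  constructor
  · intro h
    refine ⟨ph A.s x, ?_, ?_⟩
    · rcases h with h | h | h
      · exact h
      · linarith [ph_nonneg A.s x]
      · linarith [ph_nonneg A.s x]
    · rw [ph_coe]; abel
  · rintro ⟨y, hy, rfl⟩
    rw [ph_of (by linarith) (by linarith)]
    exact Or.inl hy

theorem compl_eq_image {A : Arc} (hA : A.s ≠ A.t) :
    (A.pts)ᶜ = (fun y : ℝ => A.s + (y : Circ)) '' Icc (ph A.s A.t) 1 := by
  have ht := ph_pos (Ne.symm hA)
  ext x
  rw [mem_compl_iff, mem_pts A.s, ph_self]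
  simp only [mem_image, mem_Icc]
  have h1 := ph_lt A.s A.t
  have h2 := ph_lt A.s x
  have h3 := ph_nonneg A.s x
  constructor
  · intro h
    push Not at h
    rcases h3.lt_or_eq with h4 | h4
    · refine ⟨ph A.s x, ⟨h.1 h4, h2.le⟩, ?_⟩
      rw [ph_coe]; abel
    · refine ⟨1, ⟨h1.le, le_rfl⟩, ?_⟩
      have : x = A.s := ph_inj A.s (h4.symm.trans (ph_self _).symm)
      rw [this]
      have : ((1:ℝ) : Circ) = 0 := AddCircle.coe_period 1
      simp [this]
  · rintro ⟨y, hy, rfl⟩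
    rcases hy.2.lt_or_eq with h4 | h4
    · rw [ph_of (by linarith) h4]
      rintro (h | h | h) <;> linarith [hy.1, h.1, h.2]
    · subst h4
      have : A.s + ((1:ℝ) : Circ) = A.s := by
        have : ((1:ℝ) : Circ) = 0 := AddCircle.coe_period 1
        simp [this]
      rw [this, ph_self]
      rintro (h | h | h) <;> linarith [h.1, h.2]

theorem cont_add (s : Circ) : Continuous (fun y : ℝ => s + (y : Circ)) := by
  have : Continuous (fun y : ℝ => (y : Circ)) := AddCircle.continuous_mk' 1
  fun_prop

theorem pts_preconn (A : Arc) : IsPreconnected A.pts := by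
  by_cases hA : A.s = A.t
  · have : A.pts = ∅ := by
      ext x; constructor
      · intro h; exact ne_of_mem h hA
      · simp
    rw [this]; exact isPreconnected_empty
  · rw [pts_eq_image hA]
    exact isPreconnected_Ioo.image _ (cont_add _).continuousOn

theorem compl_preconn {A : Arc} (hA : A.s ≠ A.t) : IsPreconnected (A.pts)ᶜ := by
  rw [compl_eq_image hA]
  exact isPreconnected_Icc.image _ (cont_add _).continuousOn

theorem pts_open (A : Arc) : IsOpen A.pts := by
  by_cases hA : A.s = A.t
  · have : A.pts = ∅ := by
      ext x; constructor
      · intro h; exact ne_of_mem h hA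
      · simp
    rw [this]; exact isOpen_empty
  · rw [← isClosed_compl_iff, compl_eq_image hA]
    exact (isCompact_Icc.image (cont_add _)).isClosed

end Geo
end NH

namespace NH

section Gen
variable {V : Type} {G : SimpleGraph V}

theorem chain {X : Type} {P : V → Prop} (J : V → Set X) (S : Set X)
    (hJ : ∀ u v, P u → P v → G.Adj u v → (J u ∩ J v).Nonempty)
    (hS : ∀ v, P v → ∀ x ∈ J v, ∀ z ∈ J v, x ∈ S → z ∈ S) {a b : V} (h : Cn G P a b) {x : X}
    (hx : x ∈ J a) (hxS : x ∈ S) : ∀ z ∈ J b, z ∈ S := by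
  refine h.induct (R := fun b => ∀ z ∈ J b, z ∈ S) (fun z hz => hS a h.left x hx z hz hxS) ?_
  intro u v hu ih huv hv z hz
  obtain ⟨w, hw1, hw2⟩ := hJ u v hu.right hv huv
  exact hS v hv w hw2 z hz (ih w hw1)

theorem interval_hch {W : V → Prop} (J : V → Set ℝ) (hO : ∀ v, W v → (J v).OrdConnected)
    (hJ : ∀ u v, W u → W v → u ≠ v → (G.Adj u v ↔ (J u ∩ J v).Nonempty))
    (hN : ∀ v, W v → (J v).Nonempty) : HchOn G W := by
  have main : ∀ v x y u1 u2, W v → W x → W y → G.Adj v x → G.Adj v y → G.Adj x u1 → G.Adj y u2 →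
      Cn G (fun z => W z ∧ av G v z) u1 u2 → ∀ a ∈ J v, a ∈ J x → ∀ b ∈ J v, b ∈ J y → a ≤ b →
      (J x ∩ J y).Nonempty := by
    intro v x y u1 u2 hv hx hy hvx hvy hxu hyu hC a ha1 ha2 b hb1 hb2 hab
    have nu : ∀ u, W u ∧ av G v u → ∀ c ∈ J v, c ∉ J u := by
      intro u hu c hc hc'
      exact hu.2.2 ((hJ u v hu.1 hv hu.2.1).2 ⟨c, hc', hc⟩)
    have hup : ∀ c ∈ J v, ∀ α ∈ J u1, c < α → ∀ β ∈ J u2, c < β := by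
      intro c hc α hα hcα
      refine chain (P := fun z => W z ∧ av G v z) J (Ioi c) (fun u w hu hw h => (hJ u w hu.1 hw.1 h.ne).1 h) ?_ hC hα hcα
      intro u hu s hs z hz hcs
      by_contra hcz
      exact nu u hu c hc ((hO u hu.1).out hz hs ⟨not_lt.1 hcz, le_of_lt hcs⟩)
    have hdn : ∀ c ∈ J v, ∀ α ∈ J u1, α < c → ∀ β ∈ J u2, β < c := by
      intro c hc α hα hcα
      refine chain (P := fun z => W z ∧ av G v z) J (Iio c) (fun u w hu hw h => (hJ u w hu.1 hw.1 h.ne).1 h) ?_ hC hα hcα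
      intro u hu s hs z hz hcs
      by_contra hcz
      exact nu u hu c hc ((hO u hu.1).out hs hz ⟨le_of_lt hcs, not_lt.1 hcz⟩)
    obtain ⟨α, hα1, hα2⟩ := (hJ x u1 hx hC.left.1 hxu.ne).1 hxu
    obtain ⟨β, hβ1, hβ2⟩ := (hJ y u2 hy hC.right.1 hyu.ne).1 hyu
    rcases lt_or_ge b α with h1 | h1
    · exact ⟨b, (hO x hx).out ha2 hα1 ⟨hab, h1.le⟩, hb2⟩
    rcases lt_or_ge α a with h2 | h2
    · have := hdn a ha1 α hα2 h2 β hβ2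
      exact ⟨a, ha2, (hO y hy).out hβ1 hb2 ⟨this.le, hab⟩⟩
    · exact absurd hα2 (nu u1 hC.left α ((hO v hv).out ha1 hb1 ⟨h2, h1⟩))
  intro v x y u1 u2 hv hx hy hvx hvy hxu hyu hC
  by_cases hxy : x = y
  · exact Or.inl hxy
  right
  rw [hJ x y hx hy hxy]
  obtain ⟨a, ha1, ha2⟩ := (hJ v x hv hx hvx.ne).1 hvx
  obtain ⟨b, hb1, hb2⟩ := (hJ v y hv hy hvy.ne).1 hvy
  rcases le_total a b with h | h
  · exact main v x y u1 u2 hv hx hy hvx hvy hxu hyu hC a ha1 ha2 b hb1 hb2 h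
  · rw [inter_comm]
    exact main v y x u2 u1 hv hy hx hvy hvx hyu hxu hC.symm b hb1 hb2 a ha1 ha2 h

theorem interval_AT (J : V → Set ℝ) (hO : ∀ v, (J v).OrdConnected)
    (hJ : ∀ u v, u ≠ v → (G.Adj u v ↔ (J u ∩ J v).Nonempty))
    (hN : ∀ v, (J v).Nonempty) (a b c : V) : ¬ IsAT G a b c := by
  rintro ⟨h1, h2, h3⟩
  have key : ∀ a b c, Cn G (av G c) a b → ∀ α ∈ J a, ∀ β ∈ J b, ∀ γ ∈ J c, α < γ → γ < β → False := by
    intro a b c hC α hα β hβ γ hγ h1 h2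
    have := chain (P := av G c) J (Iio γ) (fun u w hu hw h => (hJ u w h.ne).1 h) (by
      intro u hu s hs z hz hcs
      by_contra hcz
      exact hu.2 ((hJ u c hu.1).2 ⟨γ, (hO u).out hs hz ⟨le_of_lt hcs, not_lt.1 hcz⟩, hγ⟩)) hC hα h1 β hβ
    exact absurd (show β < γ from this) (not_lt.2 h2.le)
  obtain ⟨α, hα⟩ := hN a
  obtain ⟨β, hβ⟩ := hN b
  obtain ⟨γ, hγ⟩ := hN c
  have ne : ∀ {u v : V} {x y : ℝ}, av G u v → x ∈ J u → y ∈ J v → x ≠ y := by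
    intro u v x y huv hx hy e
    exact huv.2 ((hJ v u huv.1).2 ⟨y, hy, e ▸ hx⟩)
  have e1 := ne h1.left hγ hα
  have e2 := ne h2.left hα hβ
  have e3 := ne h3.left hβ hγ
  rcases lt_or_gt_of_ne e1 with g1 | g1 <;> rcases lt_or_gt_of_ne e2 with g2 | g2 <;>
    rcases lt_or_gt_of_ne e3 with g3 | g3
  · linarith
  · exact key c b a h2.symm γ hγ β hβ α hα g1 g2
  · exact key b a c h1.symm β hβ α hα γ hγ g3 g1
  · exact key c a b h3 γ hγ α hα β hβ g3 g2
  · exact key a c b h3.symm α hα γ hγ β hβ g2 g3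
  · exact key a b c h1 α hα β hβ γ hγ g1 g3
  · exact key b c a h2 β hβ γ hγ α hα g2 g1
  · linarith

/-- One dimensional Helly. -/
theorem helly1 [Fintype V] (J : V → Set ℝ) (S : Set V) (hS : S.Nonempty)
    (hO : ∀ v ∈ S, (J v).OrdConnected) (hJ : ∀ u ∈ S, ∀ v ∈ S, (J u ∩ J v).Nonempty) :
    ∃ y, ∀ v ∈ S, y ∈ J v := by
  classical
  have := Convex.helly_theorem' (𝕜 := ℝ) (F := J) (s := S.toFinset)
    (fun i hi => (hO i (by simpa using hi)).convex) (by
      intro I hI hcard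
      simp only [Module.finrank_self] at hcard
      have hI' : ∀ i ∈ I, i ∈ S := fun i hi => by simpa using hI hi
      rcases Nat.lt_or_ge I.card 2 with h | h
      · rcases Nat.lt_or_ge I.card 1 with h | h
        · have : I = ∅ := Finset.card_eq_zero.1 (by omega)
          subst this; simp
        · obtain ⟨u, rfl⟩ := Finset.card_eq_one.1 (show I.card = 1 by omega)
          obtain ⟨y, hy, _⟩ := hJ u (hI' u (by simp)) u (hI' u (by simp))
          exact ⟨y, by simpa using hy⟩
      · obtain ⟨u, v, huv, rfl⟩ := Finset.card_eq_two.1 (show I.card = 2 by omega)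
        obtain ⟨y, hy, hy'⟩ := hJ u (hI' u (by simp)) v (hI' v (by simp))
        exact ⟨y, by simp [hy, hy']⟩)
  obtain ⟨y, hy⟩ := this
  refine ⟨y, fun v hv => ?_⟩
  simp only [mem_iInter] at hy
  exact hy v (by simpa using hv)

end Gen

section Mod
variable {V : Type} [Fintype V] {G : SimpleGraph V} {M : CAModel V}

/-- points of the arc of a vertex -/
def pt (M : CAModel V) (v : V) : Set Circ := (M.arc v).pts

theorem st_ne (M : CAModel V) (v : V) : (M.arc v).s ≠ (M.arc v).t := by
  intro h
  have := @M.endpoints_distinct (v, true) (v, false) (by simpa using h)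
  simp at this

theorem pt_nonempty (M : CAModel V) (v : V) : (pt M v).Nonempty := by
  unfold pt
  rw [pts_eq_image (st_ne M v)]
  have := ph_pos (st_ne M v).symm
  exact (nonempty_Ioo.2 this).image _

theorem s_not_mem (A : Arc) : A.s ∉ A.pts := by
  rw [mem_pts A.s]
  rintro (h | h | h) <;> linarith [h.1, h.2]

theorem t_not_mem (A : Arc) : A.t ∉ A.pts := by
  rw [mem_pts A.s]
  rintro (h | h | h) <;> linarith [h.1, h.2]

theorem ordConn_image {q : Circ} {T : Set Circ}
    (hT : ∀ x ∈ T, ∀ z ∈ T, ∀ y, ph q x ≤ ph q y → ph q y ≤ ph q z → y ∈ T) :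
    (ph q '' T).OrdConnected := by
  constructor
  rintro _ ⟨x, hx, rfl⟩ _ ⟨z, hz, rfl⟩ y ⟨h1, h2⟩
  have hy : ph q (q + (y : Circ)) = y :=
    ph_of (by linarith [ph_nonneg q x]) (by linarith [ph_lt q z])
  exact ⟨q + (y : Circ), hT x hx z hz _ (by rw [hy]; exact h1) (by rw [hy]; exact h2), hy⟩

theorem inter_image {q : Circ} {T T' : Set Circ} :
    (ph q '' T ∩ ph q '' T').Nonempty ↔ (T ∩ T').Nonempty := by
  rw [← image_inter (ph_inj q), image_nonempty]

theorem ordConn_not {q : Circ} {v : V} (hq : q ∉ pt M v) : (ph q '' pt M v).OrdConnected :=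
  ordConn_image fun _ hx _ hz _ h1 h2 => convex_of_not hq hx hz h1 h2

theorem trace_ord (hM : M.Normal) {q : Circ} {u v : V} (hq : q ∉ pt M u) :
    (ph q '' (pt M v ∩ pt M u)).OrdConnected := by
  refine ordConn_image fun x hx z hz y h1 h2 => ?_
  have hyu : y ∈ pt M u := convex_of_not hq hx.2 hz.2 h1 h2
  refine ⟨?_, hyu⟩
  by_cases huv : v = u
  · rw [huv]; exact hyu
  rcases side (q := q) hx.1 hz.1 (by linarith) with h | h
  · exact h y h1 h2
  · exfalso
    apply hM v u huv
    rw [eq_univ_iff_forall]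
    intro w
    by_cases hw : ph q w ≤ ph q x ∨ ph q z ≤ ph q w
    · exact Or.inl (h w hw)
    · push Not at hw
      exact Or.inr (convex_of_not hq hx.2 hz.2 hw.1.le hw.2.le)

theorem model_adj (hG : M.IsModelOf G) {u v : V} (h : u ≠ v) :
    G.Adj u v ↔ (pt M u ∩ pt M v).Nonempty := by
  rw [hG u v]; exact ⟨fun h => h.2, fun h' => ⟨h, h'⟩⟩

theorem adj_of_mem (hG : M.IsModelOf G) {u v : V} {x : Circ} (h : u ≠ v) (hu : x ∈ pt M u)
    (hv : x ∈ pt M v) : G.Adj u v := (model_adj hG h).2 ⟨x, hu, hv⟩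

theorem av_not_mem (hG : M.IsModelOf G) {u v : V} {x : Circ} (h : av G u v) (hu : x ∈ pt M u) :
    x ∉ pt M v := fun hv => h.2 (adj_of_mem hG h.1 hv hu)

theorem hch_uncovered (hG : M.IsModelOf G) {W : V → Prop} {q : Circ} (hq : ∀ v, W v → q ∉ pt M v) :
    HchOn G W :=
  interval_hch (fun v => ph q '' pt M v) (fun v hv => ordConn_not (hq v hv))
    (fun u v _ _ huv => by rw [inter_image, model_adj hG huv])
    (fun v _ => (pt_nonempty M v).image _)

theorem AT_uncovered (hG : M.IsModelOf G) {q : Circ} (hq : ∀ v, q ∉ pt M v) (a b c : V) :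
    ¬ IsAT G a b c :=
  interval_AT (fun v => ph q '' pt M v) (fun v => ordConn_not (hq v))
    (fun u v huv => by rw [inter_image, model_adj hG huv])
    (fun v => (pt_nonempty M v).image _) a b c

theorem helly_image {q : Circ} {S : Set V} (T : V → Set Circ) (hS : S.Nonempty)
    (hO : ∀ v ∈ S, (ph q '' T v).OrdConnected) (hJ : ∀ u ∈ S, ∀ v ∈ S, (T u ∩ T v).Nonempty) :
    ∃ p, ∀ v ∈ S, p ∈ T v := by
  obtain ⟨y, hy⟩ := helly1 (fun v => ph q '' T v) S hS hO
    (fun u hu v hv => inter_image.2 (hJ u hu v hv))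
  obtain ⟨u, hu⟩ := hS
  obtain ⟨p, hp, hpy⟩ := hy u hu
  refine ⟨p, fun v hv => ?_⟩
  obtain ⟨p', hp', hpy'⟩ := hy v hv
  rwa [ph_inj q (hpy.trans hpy'.symm)]

theorem helly_on {q : Circ} {S : Set V} (hS : S.Nonempty) (hq : ∀ v ∈ S, q ∉ pt M v)
    (hJ : ∀ u ∈ S, ∀ v ∈ S, M.Inter u v) : ∃ p, ∀ v ∈ S, p ∈ pt M v :=
  helly_image (q := q) (pt M) hS (fun v hv => ordConn_not (hq v hv)) hJ

theorem nh_uncovered {q : Circ} (hq : ∀ v, q ∉ pt M v) : M.Normal ∧ M.Helly := by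
  constructor
  · intro u v _ h
    have : q ∈ (M.arc u).pts ∪ (M.arc v).pts := h ▸ mem_univ q
    rcases this with h | h
    · exact hq u h
    · exact hq v h
  · intro S hS
    rcases S.eq_empty_or_nonempty with rfl | hne
    · exact ⟨0, by simp⟩
    · exact helly_on hne (fun v _ => hq v) hS

def Cov (M : CAModel V) (a b c : V) : Prop := pt M a ∪ pt M b ∪ pt M c = univ

theorem exists_cov (hM : M.Normal) (hnH : ¬ M.Helly) :
    ∃ a b c, a ≠ b ∧ a ≠ c ∧ b ≠ c ∧ Cov M a b c := by
  by_contra hc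
  push Not at hc
  apply hnH
  intro S hS
  rcases S.eq_empty_or_nonempty with rfl | ⟨u, hu⟩
  · exact ⟨0, by simp⟩
  have hq := s_not_mem (M.arc u)
  obtain ⟨p, hp⟩ := helly_image (q := (M.arc u).s) (S := S) (fun v => pt M v ∩ pt M u) ⟨u, hu⟩
    (fun v _ => trace_ord hM hq) (by
      intro v hv w hw
      by_cases h1 : v = w
      · subst h1
        obtain ⟨x, hx⟩ := hS v hv u hu
        exact ⟨x, hx, hx⟩
      by_cases h2 : v = u
      · subst h2
        obtain ⟨x, hx⟩ := hS v hv w hw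
        exact ⟨x, ⟨hx.1, hx.1⟩, ⟨hx.2, hx.1⟩⟩
      by_cases h3 : w = u
      · subst h3
        obtain ⟨x, hx⟩ := hS v hv w hw
        exact ⟨x, ⟨hx.1, hx.2⟩, ⟨hx.2, hx.2⟩⟩
      have := hc v w u h1 h2 h3
      unfold Cov at this
      rw [eq_univ_iff_forall] at this
      push Not at this
      obtain ⟨q, hq⟩ := this
      simp only [mem_union, not_or] at hq
      obtain ⟨p, hp⟩ := helly_on (M := M) (q := q) (S := {v, w, u}) ⟨u, by simp⟩
        (by simp [hq.1.1, hq.1.2, hq.2]) (by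
          intro a ha b hb
          have key : ∀ z ∈ ({v, w, u} : Set V), z ∈ S := by
            rintro z (rfl | rfl | rfl) <;> assumption
          exact hS a (key a ha) b (key b hb))
      exact ⟨p, ⟨hp v (by simp), hp u (by simp)⟩, ⟨hp w (by simp), hp u (by simp)⟩⟩)
  exact ⟨p, fun v hv => (hp v hv).1⟩

theorem star_free (hG : M.IsModelOf G) : StarFree G := by
  have key : ∀ (y a b c : V), Cn G (fun z => av G a z ∧ av G c z) y b →
      ∀ q ∈ pt M y, ∀ α ∈ pt M a, ∀ β ∈ pt M b, ∀ γ ∈ pt M c, ph q α < ph q β → ph q β < ph q γ →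
      False := by
    intro y a b c hC q hq α hα β hβ γ hγ h1 h2
    have := chain (P := fun z => av G a z ∧ av G c z) (pt M) {z | ph q α < ph q z ∧ ph q z < ph q γ}
      (fun u v _ _ h => (model_adj hG h.ne).1 h) (by
        intro v hv x hx z hz hxS
        exact two (av_not_mem hG hv.1 hα) (av_not_mem hG hv.2 hγ) (h1.trans h2) hx hz hxS)
      hC.symm hβ ⟨h1, h2⟩ q hq
    have h3 := this.1
    rw [ph_self] at h3
    linarith [ph_nonneg q α]
  intro y a b c h1 h2 h3
  obtain ⟨q, hq⟩ := pt_nonempty M y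
  obtain ⟨α, hα⟩ := pt_nonempty M a
  obtain ⟨β, hβ⟩ := pt_nonempty M b
  obtain ⟨γ, hγ⟩ := pt_nonempty M c
  have ne : ∀ {u v : V} {x z : Circ}, av G u v → x ∈ pt M u → z ∈ pt M v → ph q x ≠ ph q z := by
    intro u v x z huv hx hz e
    exact av_not_mem hG huv hx (ph_inj q e ▸ hz)
  have e1 := ne h1.right.1 hβ hα
  have e2 := ne h1.right.2 hγ hα
  have e3 := ne h2.right.2 hγ hβ
  have s1 := h1.mono (Q := fun z => av G c z ∧ av G b z) fun _ h => h.symm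
  have s2 := h2.mono (Q := fun z => av G c z ∧ av G a z) fun _ h => h.symm
  have s3 := h3.mono (Q := fun z => av G b z ∧ av G a z) fun _ h => h.symm
  rcases lt_or_gt_of_ne e1 with g1 | g1 <;> rcases lt_or_gt_of_ne e2 with g2 | g2 <;>
    rcases lt_or_gt_of_ne e3 with g3 | g3
  · exact key y c b a s2 q hq γ hγ β hβ α hα g3 g1
  · exact key y b c a s3 q hq β hβ γ hγ α hα g3 g2
  · linarith
  · exact key y b a c h1 q hq β hβ α hα γ hγ g1 g2
  · exact key y c a b s1 q hq γ hγ α hα β hβ g2 g1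
  · linarith
  · exact key y a c b h3 q hq α hα γ hγ β hβ g2 g3
  · exact key y a b c h2 q hq α hα β hβ γ hγ g1 g3

end Mod
end NH

namespace NH

section Mk
variable {V : Type} [Fintype V] {G : SimpleGraph V}

theorem interval_model (l r : V → ℝ) (hl : ∀ v, 0 < l v) (hlr : ∀ v, l v < r v) (hr : ∀ v, r v < 1)
    (h1 : ∀ u v, l u = l v → u = v) (h2 : ∀ u v, r u = r v → u = v) (h3 : ∀ u v, l u ≠ r v)
    (hadj : ∀ u v, u ≠ v → (G.Adj u v ↔ l u < r v ∧ l v < r u)) : IsNHCAGraph G := by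
  have pc : ∀ y : ℝ, 0 ≤ y → y < 1 → ph 0 (y : Circ) = y := by
    intro y h h'
    have := ph_of (q := 0) h h'
    simpa using this
  have pl : ∀ v, ph 0 (l v : Circ) = l v := fun v => pc _ (hl v).le ((hlr v).trans (hr v))
  have pr : ∀ v, ph 0 (r v : Circ) = r v := fun v => pc _ ((hl v).trans (hlr v)).le (hr v)
  let M : CAModel V := ⟨fun v => ⟨(l v : Circ), (r v : Circ)⟩, by
    rintro ⟨u, b⟩ ⟨v, c⟩ h
    have h := congrArg (ph 0) h
    cases b <;> cases c <;> simp only [Bool.false_eq_true, if_true, if_false, pl, pr] at h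
    · rw [h2 _ _ h]
    · exact absurd h.symm (h3 _ _)
    · exact absurd h (h3 _ _)
    · rw [h1 _ _ h]⟩
  have mem : ∀ v x, x ∈ pt M v ↔ l v < ph 0 x ∧ ph 0 x < r v := by
    intro v x
    unfold pt
    rw [mem_pts 0]
    change (ph 0 (l v : Circ) < _ ∧ _ < ph 0 (r v : Circ)) ∨ (_ ∧ ph 0 (r v : Circ) < ph 0 (l v : Circ)) ∨
      (ph 0 (r v : Circ) < ph 0 (l v : Circ) ∧ _) ↔ _
    rw [pl, pr]
    have := hlr v
    constructor
    · rintro (h | h | h)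
      · exact h
      · linarith [h.2]
      · linarith [h.1]
    · exact Or.inl
  have hq : ∀ v, (0 : Circ) ∉ pt M v := by
    intro v hv
    rw [mem, ph_self] at hv
    linarith [hl v, hv.1]
  refine ⟨M, (nh_uncovered hq).1, (nh_uncovered hq).2, ?_⟩
  intro u v
  by_cases huv : u = v
  · subst huv; simp
  rw [hadj u v huv]
  constructor
  · rintro ⟨ha, hb⟩
    refine ⟨huv, ?_⟩
    have : max (l u) (l v) < min (r u) (r v) := by
      simp [ha, hb, hlr u, hlr v]
    obtain ⟨y, hy1, hy2⟩ := exists_between this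
    rw [max_lt_iff] at hy1
    rw [lt_min_iff] at hy2
    have hy : ph 0 (y : Circ) = y := pc y (by linarith [hl u]) (by linarith [hr u])
    exact ⟨(y : Circ), (mem u _).2 (by rw [hy]; exact ⟨hy1.1, hy2.1⟩), (mem v _).2 (by rw [hy]; exact ⟨hy1.2, hy2.2⟩)⟩
  · rintro ⟨_, x, hx, hx'⟩
    have hx := (mem u x).1 hx
    have hx' := (mem v x).1 hx'
    exact ⟨hx.1.trans hx'.2, hx'.1.trans hx.2⟩

theorem model_of_ordering (f : V → ℕ) (hf : Function.Injective f)
    (ho : ∀ u v w, f u < f v → f v < f w → G.Adj u w → G.Adj u v) : IsNHCAGraph G := by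
  classical
  obtain ⟨N, hN⟩ : ∃ N, ∀ v, f v < N :=
    ⟨Finset.univ.sup f + 1, fun v => Nat.lt_succ_of_le (Finset.le_sup (Finset.mem_univ v))⟩
  have hR : ∀ v, ∃ w, (w = v ∨ G.Adj v w) ∧ ∀ z, (z = v ∨ G.Adj v z) → f z ≤ f w := by
    intro v
    obtain ⟨w, hw, hw'⟩ := Finset.exists_max_image (Finset.univ.filter fun w => w = v ∨ G.Adj v w) f
      ⟨v, by simp⟩
    refine ⟨w, by simpa using hw, fun z hz => hw' z (by simpa using hz)⟩
  choose R hR1 hR2 using hR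
  have hfR : ∀ v, f v ≤ f (R v) := fun v => hR2 v v (Or.inl rfl)
  have adj : ∀ u v, f u < f v → (G.Adj u v ↔ f v ≤ f (R u)) := by
    intro u v huv
    refine ⟨fun h => hR2 u v (Or.inr h), fun h => ?_⟩
    rcases hR1 u with h' | h'
    · rw [h'] at h; omega
    rcases h.lt_or_eq with h'' | h''
    · exact ho _ _ _ huv h'' h'
    · rwa [hf h'']
  have hK : (0:ℝ) < 4 * (N + 3) ^ 2 := by positivity
  -- numerators over the integers, scaled by `4 (N+3)`
  let L : V → ℕ := fun v => 4 * (N + 3) * (f v + 1)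
  let T : V → ℕ := fun v => 4 * (N + 3) * (f (R v) + 1) + 2 * (N + 3) + f v
  have hT : ∀ v, T v < 4 * (N + 3) ^ 2 := by
    intro v
    have := hN v; have := hN (R v)
    simp only [T]; nlinarith
  have LT : ∀ u v, L u < T v ↔ f u ≤ f (R v) := by
    intro u v
    simp only [L, T]
    have := hN v
    constructor
    · intro h; by_contra h'; push Not at h'
      nlinarith
    · intro h; nlinarith
  have TL : ∀ u v, T v < L u ↔ f (R v) < f u := by
    intro u v
    simp only [L, T]
    have := hN v
    constructor
    · intro h; by_contra h'; push Not at h'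
      nlinarith
    · intro h
      have : f (R v) + 1 ≤ f u := h
      nlinarith
  have TT : ∀ u v, T u = T v → u = v := by
    intro u v h
    simp only [T] at h
    have h1 := hN u
    have h2 := hN v
    apply hf
    rcases lt_trichotomy (f (R u)) (f (R v)) with h' | h' | h'
    · have : f (R u) + 1 ≤ f (R v) := h'
      nlinarith
    · rw [h'] at h; omega
    · have : f (R v) + 1 ≤ f (R u) := h'
      nlinarith
  have sc : ∀ a b : ℕ, (a:ℝ) / (4 * (N + 3) ^ 2) < b / (4 * (N + 3) ^ 2) ↔ a < b := by
    intro a b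
    rw [div_lt_div_iff_of_pos_right hK, Nat.cast_lt]
  have se : ∀ a b : ℕ, (a:ℝ) / (4 * (N + 3) ^ 2) = b / (4 * (N + 3) ^ 2) ↔ a = b := by
    intro a b
    rw [div_left_inj' hK.ne', Nat.cast_inj]
  refine interval_model (fun v => (L v : ℝ) / (4 * (N + 3) ^ 2)) (fun v => (T v : ℝ) / (4 * (N + 3) ^ 2))
    ?_ ?_ ?_ ?_ ?_ ?_ ?_
  · intro v
    have : 0 < L v := by simp only [L]; positivity
    have : (0:ℝ) < L v := by exact_mod_cast this
    positivity
  · intro v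
    exact (sc _ _).2 ((LT v v).2 (hfR v))
  · intro v
    rw [div_lt_one hK]
    exact_mod_cast hT v
  · intro u v h
    have h := (se _ _).1 h
    simp only [L] at h
    apply hf
    have := Nat.eq_of_mul_eq_mul_left (by positivity) h
    omega
  · intro u v h
    exact TT u v ((se _ _).1 h)
  · intro u v h
    have h := (se _ _).1 h
    rcases le_or_gt (f u) (f (R v)) with h' | h'
    · have := (LT u v).2 h'; omega
    · have := (TL u v).2 h'; omega
  · intro u v huv
    simp only [sc, LT]
    rcases lt_or_gt_of_ne (fun h => huv (hf h) : f u ≠ f v) with h | h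
    · rw [adj u v h]
      exact ⟨fun h' => ⟨h.le.trans (hfR v), h'⟩, fun h' => h'.2⟩
    · rw [G.adj_comm, adj v u h]
      exact ⟨fun h' => ⟨h', h.le.trans (hfR u)⟩, fun h' => h'.1⟩

end Mk
end NH

namespace NH

section Arcs

theorem mid {p α β γ : Circ} {B t : Arc} (h1 : ph p α < ph p β) (h2 : ph p β < ph p γ)
    (hβ : β ∈ B.pts) (hαB : α ∉ B.pts) (hγB : γ ∉ B.pts) (hαt : α ∉ t.pts) (hγt : γ ∉ t.pts)
    (hp : p ∈ t.pts) (hm : (t.pts ∩ B.pts).Nonempty) : False := by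
  obtain ⟨w, hw, hw'⟩ := hm
  have := two hαB hγB (h1.trans h2) hβ hw' ⟨h1, h2⟩
  have := (two hαt hγt (h1.trans h2) hw hp this).1
  rw [ph_self] at this
  linarith [ph_nonneg p α]

theorem sep3 {x y z p : Circ} {A B C : Arc} (hxA : x ∈ A.pts) (hxB : x ∉ B.pts) (hxC : x ∉ C.pts)
    (hyA : y ∉ A.pts) (hyB : y ∈ B.pts) (hyC : y ∉ C.pts)
    (hzA : z ∉ A.pts) (hzB : z ∉ B.pts) (hzC : z ∈ C.pts)
    (hA : ph p y < ph p x → ph p x < ph p z → False) (hA' : ph p z < ph p x → ph p x < ph p y → False)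
    (hB : ph p x < ph p y → ph p y < ph p z → False) (hB' : ph p z < ph p y → ph p y < ph p x → False)
    (hC : ph p x < ph p z → ph p z < ph p y → False) (hC' : ph p y < ph p z → ph p z < ph p x → False) :
    False := by
  have e1 : ph p x ≠ ph p y := fun e => hyA (ph_inj p e ▸ hxA)
  have e2 : ph p x ≠ ph p z := fun e => hzA (ph_inj p e ▸ hxA)
  have e3 : ph p y ≠ ph p z := fun e => hzB (ph_inj p e ▸ hyB)
  rcases lt_or_gt_of_ne e1 with g1 | g1 <;> rcases lt_or_gt_of_ne e2 with g2 | g2 <;>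
    rcases lt_or_gt_of_ne e3 with g3 | g3
  all_goals first | exact hA g1 g2 | exact hA' g2 g1 | exact hB g1 g3 | exact hB' g3 g1 | exact hC g2 g3 |
    exact hC' g3 g2 | linarith

theorem sep_common {x y z p : Circ} {A B C : Arc} (hxA : x ∈ A.pts) (hxB : x ∉ B.pts) (hxC : x ∉ C.pts)
    (hyA : y ∉ A.pts) (hyB : y ∈ B.pts) (hyC : y ∉ C.pts)
    (hzA : z ∉ A.pts) (hzB : z ∉ B.pts) (hzC : z ∈ C.pts)
    (pA : p ∈ A.pts) (pB : p ∈ B.pts) (pC : p ∈ C.pts) : False :=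
  sep3 (p := p) hxA hxB hxC hyA hyB hyC hzA hzB hzC
    (fun h1 h2 => mid h1 h2 hxA hyA hzA hyA hzA pA ⟨p, pA, pA⟩)
    (fun h1 h2 => mid h1 h2 hxA hzA hyA hzA hyA pA ⟨p, pA, pA⟩)
    (fun h1 h2 => mid h1 h2 hyB hxB hzB hxB hzB pB ⟨p, pB, pB⟩)
    (fun h1 h2 => mid h1 h2 hyB hzB hxB hzB hxB pB ⟨p, pB, pB⟩)
    (fun h1 h2 => mid h1 h2 hzC hxC hyC hxC hyC pC ⟨p, pC, pC⟩)
    (fun h1 h2 => mid h1 h2 hzC hyC hxC hyC hxC pC ⟨p, pC, pC⟩)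

theorem sep_t {x y z : Circ} {A B C t : Arc} (hxA : x ∈ A.pts) (hxB : x ∉ B.pts) (hxC : x ∉ C.pts)
    (hyA : y ∉ A.pts) (hyB : y ∈ B.pts) (hyC : y ∉ C.pts)
    (hzA : z ∉ A.pts) (hzB : z ∉ B.pts) (hzC : z ∈ C.pts)
    (xt : x ∉ t.pts) (yt : y ∉ t.pts) (zt : z ∉ t.pts)
    (tA : (t.pts ∩ A.pts).Nonempty) (tB : (t.pts ∩ B.pts).Nonempty) (tC : (t.pts ∩ C.pts).Nonempty) :
    False := by
  obtain ⟨p, hp, _⟩ := id tA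
  exact sep3 (p := p) hxA hxB hxC hyA hyB hyC hzA hzB hzC
    (fun h1 h2 => mid h1 h2 hxA hyA hzA yt zt hp tA)
    (fun h1 h2 => mid h1 h2 hxA hzA hyA zt yt hp tA)
    (fun h1 h2 => mid h1 h2 hyB hxB hzB xt zt hp tB)
    (fun h1 h2 => mid h1 h2 hyB hzB hxB zt xt hp tB)
    (fun h1 h2 => mid h1 h2 hzC hxC hyC xt yt hp tC)
    (fun h1 h2 => mid h1 h2 hzC hyC hxC yt xt hp tC)

/-- If `C` contains `u < w`, misses a point strictly between them, and `A ∋ p` misses `u`, `w`,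
then `A ⊆ C` (coordinates from `p`). -/
theorem outer_sub {p u v w : Circ} {A C : Arc} (hu : u ∈ C.pts) (hw : w ∈ C.pts) (hv : v ∉ C.pts)
    (h1 : ph p u < ph p v) (h2 : ph p v < ph p w) (hp : p ∈ A.pts) (huA : u ∉ A.pts) (hwA : w ∉ A.pts) :
    ∀ x ∈ A.pts, x ∈ C.pts := by
  intro x hx
  rcases side (q := p) hu hw (h1.trans h2).le with h | h
  · exact absurd (h v h1.le h2.le) hv
  · apply h
    by_contra hc
    push Not at hc
    have := (two huA hwA (h1.trans h2) hx hp hc).1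
    rw [ph_self] at this
    linarith [ph_nonneg p u]

theorem tc3_aux {A B C t : Arc} {p y z y' z' x : Circ} (hyz : ph p y < ph p z)
    (pA : p ∈ A.pts) (pt' : p ∉ t.pts)
    (yA : y ∉ A.pts) (yB : y ∈ B.pts) (yC : y ∉ C.pts) (yt : y ∉ t.pts)
    (zA : z ∉ A.pts) (zB : z ∉ B.pts) (zC : z ∈ C.pts) (zt : z ∉ t.pts)
    (yA' : y' ∉ A.pts) (yB' : y' ∈ B.pts) (yC' : y' ∉ C.pts) (yt' : y' ∈ t.pts)
    (zA' : z' ∉ A.pts) (zB' : z' ∉ B.pts) (zC' : z' ∈ C.pts) (zt' : z' ∈ t.pts)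
    (xA : x ∈ A.pts) (xB : x ∉ B.pts) (xC : x ∉ C.pts) (xt : x ∈ t.pts) : False := by
  have ne : ∀ {D : Arc} {a b : Circ}, a ∈ D.pts → b ∉ D.pts → ph p a ≠ ph p b :=
    fun ha hb e => hb (ph_inj p e ▸ ha)
  -- not strictly between
  have nb : ∀ w ∈ t.pts, ph p y < ph p w → ph p w < ph p z → False := by
    intro w hw h1 h2
    have h3 := two yt zt hyz hw xt ⟨h1, h2⟩
    have h4 := (two yA zA hyz xA pA h3).1
    rw [ph_self] at h4
    linarith [ph_nonneg p y]
  have e1 := ne yt' yt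
  have e2 := ne zt' zt
  have e3 := ne yB' zB'
  have e4 := ne zC' yC
  have e5 := ne yB' zB
  rcases lt_or_gt_of_ne e1 with g1 | g1
  · -- y' < y
    have g2 : ph p z' < ph p y := by
      by_contra hc
      push Not at hc
      exact yt (convex_of_not pt' yt' zt' g1.le hc)
    rcases lt_or_gt_of_ne e3 with g3 | g3
    · rcases side (q := p) yB' yB g1.le with h | h
      · exact zB' (h z' g3.le g2.le)
      · exact zB (h z (Or.inr hyz.le))
    · exact xC (outer_sub zC' zC yC g2 hyz pA zA' zA x xA)
  · have g4 : ph p z < ph p y' := by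
      by_contra hc
      push Not at hc
      exact nb y' yt' g1 (lt_of_le_of_ne hc e5)
    have g5 : ph p z < ph p z' := by
      by_contra hc
      push Not at hc
      exact zt (convex_of_not pt' zt' yt' hc g4.le)
    rcases lt_or_gt_of_ne e3 with g3 | g3
    · rcases side (q := p) zC zC' g5.le with h | h
      · exact yC' (h y' g4.le g3.le)
      · exact yC (h y (Or.inl hyz.le))
    · exact xB (outer_sub yB yB' zB hyz g4 pA yA yA' x xA)

end Arcs

section Cover
variable {V : Type} [Fintype V] {G : SimpleGraph V} {M : CAModel V} {a b c t : V}

theorem Cov.mem (h : Cov M a b c) (x : Circ) : x ∈ pt M a ∨ x ∈ pt M b ∨ x ∈ pt M c := by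
  have : x ∈ pt M a ∪ pt M b ∪ pt M c := h ▸ mem_univ x
  simpa [or_assoc] using this

theorem cov_of (h : ∀ x, x ∈ pt M a ∨ x ∈ pt M b ∨ x ∈ pt M c) : Cov M a b c := by
  unfold Cov
  rw [eq_univ_iff_forall]
  intro x
  simpa [or_assoc] using h x

theorem Cov.swap (h : Cov M a b c) : Cov M b a c := cov_of fun x => by have := h.mem x; tauto
theorem Cov.rot (h : Cov M a b c) : Cov M b c a := cov_of fun x => by have := h.mem x; tauto

theorem not_cov (h : ¬ Cov M a b c) : ∃ x, x ∉ pt M a ∧ x ∉ pt M b ∧ x ∉ pt M c := by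
  by_contra hc
  push Not at hc
  exact h (cov_of fun x => by have := hc x; tauto)

theorem Cov.excl (hM : M.Normal) (h : Cov M a b c) (hbc : b ≠ c) :
    ∃ x, x ∈ pt M a ∧ x ∉ pt M b ∧ x ∉ pt M c := by
  have := hM b c hbc
  rw [Ne, eq_univ_iff_forall] at this
  push Not at this
  obtain ⟨x, hx⟩ := this
  have h1 : x ∉ pt M b := fun h => hx (Or.inl h)
  have h2 : x ∉ pt M c := fun h => hx (Or.inr h)
  have := h.mem x
  exact ⟨x, by tauto, h1, h2⟩

theorem Cov.meet (hM : M.Normal) (h : Cov M a b c) (hac : a ≠ c) (hbc : b ≠ c) :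
    (pt M a ∩ pt M b).Nonempty := by
  have hc : IsPreconnected (pt M c)ᶜ := compl_preconn (st_ne M c)
  obtain ⟨x, hx1, hx2, hx3⟩ := h.excl hM hbc
  obtain ⟨y, hy1, hy2, hy3⟩ := h.swap.excl hM hac
  obtain ⟨z, _, hz⟩ := hc (pt M a) (pt M b) (pts_open _) (pts_open _)
    (fun x hx => by have := h.mem x; have : x ∉ pt M c := hx; simp only [mem_union]; tauto)
    ⟨x, hx3, hx1⟩ ⟨y, hy3, hy1⟩
  exact ⟨z, hz⟩

theorem Cov.adj (hG : M.IsModelOf G) (hM : M.Normal) (h : Cov M a b c) (hab : a ≠ b) (hac : a ≠ c)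
    (hbc : b ≠ c) : G.Adj a b := (model_adj hG hab).2 (h.meet hM hac hbc)

theorem Cov.no_common (hM : M.Normal) (h : Cov M a b c) (hab : a ≠ b) (hac : a ≠ c)
    (hbc : b ≠ c) {p : Circ} (pa : p ∈ pt M a) (pb : p ∈ pt M b) (pc : p ∈ pt M c) : False := by
  obtain ⟨x, hx1, hx2, hx3⟩ := h.excl hM hbc
  obtain ⟨y, hy1, hy2, hy3⟩ := h.rot.excl hM hac.symm
  obtain ⟨z, hz1, hz2, hz3⟩ := h.rot.rot.excl hM hab
  exact sep_common hx1 hx2 hx3 hy3 hy1 hy2 hz2 hz3 hz1 pa pb pc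

theorem Cov.tc2 (h : Cov M a b c) 
    (ta : (pt M t ∩ pt M a).Nonempty) (tb : (pt M t ∩ pt M b).Nonempty)
    (tc : (pt M t ∩ pt M c).Nonempty) : Cov M t b c ∨ Cov M a t c ∨ Cov M a b t := by
  by_contra hc
  push Not at hc
  obtain ⟨x, hx1, hx2, hx3⟩ := not_cov hc.1
  obtain ⟨y, hy1, hy2, hy3⟩ := not_cov hc.2.1
  obtain ⟨z, hz1, hz2, hz3⟩ := not_cov hc.2.2
  have hx := h.mem x
  have hy := h.mem y
  have hz := h.mem z
  exact sep_t (t := M.arc t) (by tauto : x ∈ (M.arc a).pts) hx2 hx3 hy1 (by tauto) hy3 hz1 hz2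
    (by tauto : z ∈ (M.arc c).pts) hx1 hy2 hz3 ta tb tc

theorem Cov.tc3 (hM : M.Normal) (h : Cov M a b c) (hbc : b ≠ c)
    (ht : Cov M t b c) (h2 : ¬ Cov M a t c) (h3 : ¬ Cov M a b t)
    (hy : ∃ y ∈ pt M t, y ∉ pt M a ∧ y ∉ pt M c) (hz : ∃ z ∈ pt M t, z ∉ pt M a ∧ z ∉ pt M b) :
    ∀ p ∈ pt M a, p ∈ pt M t := by
  intro p pa
  by_contra pt'
  obtain ⟨x, hx1, hx2, hx3⟩ := h.excl hM hbc
  obtain ⟨y, hy1, hy2, hy3⟩ := not_cov h2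
  obtain ⟨z, hz1, hz2, hz3⟩ := not_cov h3
  obtain ⟨y', hy1', hy2', hy3'⟩ := hy
  obtain ⟨z', hz1', hz2', hz3'⟩ := hz
  have yb : y ∈ pt M b := by have := h.mem y; tauto
  have zc : z ∈ pt M c := by have := h.mem z; tauto
  have yb' : y' ∈ pt M b := by have := h.mem y'; tauto
  have zc' : z' ∈ pt M c := by have := h.mem z'; tauto
  have xt : x ∈ pt M t := by have := ht.mem x; tauto
  rcases lt_trichotomy (ph p y) (ph p z) with g | g | g
  · exact tc3_aux g pa pt' hy1 yb hy3 hy2 hz1 hz2 zc hz3 hy2' yb' hy3' hy1' hz2' hz3' zc' hz1'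
      hx1 hx2 hx3 xt
  · exact hy3 (ph_inj p g ▸ zc)
  · exact tc3_aux g pa pt' hz1 zc hz2 hz3 hy1 hy3 yb hy2 hz2' zc' hz3' hz1' hy2' hy3' yb' hy1'
      hx1 hx3 hx2 xt

end Cover
end NH

namespace NH

section Hole
variable {V : Type} {G : SimpleGraph V}

structure IsHole (G : SimpleGraph V) (n : ℕ) (f : ℕ → V) : Prop where
  four : 4 ≤ n
  inj : ∀ i j, i < j → j < n → f i ≠ f j
  adj : ∀ i j, i < j → j < n → (G.Adj (f i) (f j) ↔ j = i + 1 ∨ (i = 0 ∧ j = n - 1))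

theorem exists_hole {P : V → Prop} (h : ¬ HchOn G P) : ∃ n f, IsHole G n f ∧ ∀ i < n, P (f i) := by
  unfold HchOn at h
  push Not at h
  obtain ⟨v, x, y, u1, u2, hv, hx, hy, hvx, hvy, hxu, hyu, hC, hne, hna⟩ := h
  let Q : V → Prop := fun z => P z ∧ (av G v z ∨ z = x ∨ z = y)
  have hCQ : Cn G Q x y :=
    Cn.tail (Cn.head hxu ⟨hx, by tauto⟩ (hC.mono fun z hz => ⟨hz.1, Or.inl hz.2⟩)) hyu.symm ⟨hy, by tauto⟩
  obtain ⟨m, g, hg, hmin⟩ := exists_min_W hCQ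
  have hm : 2 ≤ m := by
    by_contra hc
    have : m = 0 ∨ m = 1 := by omega
    rcases this with rfl | rfl
    · exact hne (hg.h0.symm.trans hg.hn)
    · have := hg.adj 0 (by omega)
      rw [hg.h0, hg.hn] at this
      exact hna this
  have hav : ∀ i, 0 < i → i < m → av G v (g i) := by
    intro i h0 h1
    rcases (hg.mem i h1.le).2 with h | h | h
    · exact h
    · have := hg.inj hmin (i := 0) (j := i) (by omega) h1.le (by rw [h, hg.h0]); omega
    · have := hg.inj hmin (i := i) (j := m) (by omega) le_rfl (by rw [h, hg.hn]); omega
  have hnev : ∀ i ≤ m, g i ≠ v := by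
    intro i hi
    rcases (hg.mem i hi).2 with h | h | h
    · exact h.1
    · rw [h]; exact hvx.ne'
    · rw [h]; exact hvy.ne'
  refine ⟨m + 2, fun i => if i ≤ m then g i else v, ⟨by omega, ?_, ?_⟩, ?_⟩
  · intro i j hij hj
    have hi : i ≤ m := by omega
    by_cases hjm : j ≤ m
    · simp only [hi, hjm, if_true]
      intro e
      have := hg.inj hmin hij.le hjm e
      omega
    · simp only [hi, hjm, if_true, if_false]
      exact hnev i hi
  · intro i j hij hj
    have hi : i ≤ m := by omega
    by_cases hjm : j ≤ m
    · simp only [hi, hjm, if_true]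
      rw [hg.ind hmin hij.le hjm]
      omega
    · simp only [hi, hjm, if_true, if_false]
      constructor
      · intro h
        by_contra hc
        exact (hav i (by omega) (by omega)).2 h
      · rintro (h | h)
        · have : i = m := by omega
          rw [this, hg.hn]; exact hvy.symm
        · rw [h.1, hg.h0]; exact hvx.symm
  · intro i hi
    by_cases him : i ≤ m
    · simp only [him, if_true]; exact (hg.mem i him).1
    · simp only [him, if_false]; exact hv

theorem wheel_inl {n : ℕ} (i j : Fin n) : (wheel n).Adj (Sum.inl i) (Sum.inl j) ↔
    i ≠ j ∧ (((i : ℕ) + 1) % n = (j : ℕ) ∨ ((j : ℕ) + 1) % n = (i : ℕ)) := by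
  unfold wheel
  rw [SimpleGraph.fromRel_adj]
  constructor
  · rintro ⟨h1, (⟨x, hx⟩ | ⟨a, b, ha, hb, h⟩) | (⟨x, hx⟩ | ⟨a, b, ha, hb, h⟩)⟩
    · cases hx
    · cases ha; cases hb; exact ⟨fun e => h1 (by rw [e]), Or.inl h⟩
    · cases hx
    · cases ha; cases hb; exact ⟨fun e => h1 (by rw [e]), Or.inr h⟩
  · rintro ⟨h1, h | h⟩
    · exact ⟨fun e => h1 (Sum.inl_injective e), Or.inl (Or.inr ⟨i, j, rfl, rfl, h⟩)⟩
    · exact ⟨fun e => h1 (Sum.inl_injective e), Or.inr (Or.inr ⟨j, i, rfl, rfl, h⟩)⟩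

theorem succ_mod {n : ℕ} (i j : Fin n) : ((i : ℕ) + 1) % n = (j : ℕ) ↔
    (j : ℕ) = i + 1 ∨ ((j : ℕ) = 0 ∧ (i : ℕ) = n - 1) := by
  have := i.2
  have := j.2
  by_cases hi : (i : ℕ) = n - 1
  · rw [hi, Nat.sub_add_cancel (by omega), Nat.mod_self]; omega
  · rw [Nat.mod_eq_of_lt (by omega)]; omega

namespace IsHole
variable {n : ℕ} {f : ℕ → V}

def On (n : ℕ) (f : ℕ → V) (z : V) : Prop := ∃ i < n, f i = z

theorem adj' (h : IsHole G n f) {i j : ℕ} (hi : i < n) (hj : j < n) : G.Adj (f i) (f j) ↔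
    j = i + 1 ∨ i = j + 1 ∨ (i = 0 ∧ j = n - 1) ∨ (j = 0 ∧ i = n - 1) := by
  have h4 := h.four
  rcases lt_trichotomy i j with h1 | h1 | h1
  · rw [h.adj i j h1 hj]; omega
  · subst h1
    constructor
    · intro h; exact absurd rfl h.ne
    · intro h; omega
  · rw [G.adj_comm, h.adj j i h1 hi]; omega

theorem inj' (h : IsHole G n f) {i j : ℕ} (hi : i < n) (hj : j < n) (e : f i = f j) : i = j := by
  rcases lt_trichotomy i j with h1 | h1 | h1
  · exact absurd e (h.inj i j h1 hj)
  · exact h1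
  · exact absurd e.symm (h.inj j i h1 hi)

theorem not_hch (h : IsHole G n f) : ¬ HchOn G (On n f) := by
  intro hH
  have h4 := h.four
  have mem : ∀ i, i < n → On n f (f i) := fun i hi => ⟨i, hi, rfl⟩
  have av' : ∀ i, 1 ≤ i → i < n - 2 → av G (f (n - 1)) (f i) := by
    intro i h1 h2
    refine ⟨h.inj i (n - 1) (by omega) (by omega), fun hA => ?_⟩
    rw [h.adj i (n - 1) (by omega) (by omega)] at hA
    omega
  have path : ∀ j, 1 ≤ j → j < n - 2 → Cn G (fun z => On n f z ∧ av G (f (n - 1)) z) (f 1) (f j) := by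
    intro j hj
    induction j, hj using Nat.le_induction with
    | base => intro hj; exact .refl ⟨mem 1 (by omega), av' 1 (by omega) (by omega)⟩
    | succ j hj ih =>
      intro hj'
      exact (ih (by omega)).tail ((h.adj' (by omega) (by omega)).2 (by omega))
        ⟨mem _ (by omega), av' _ (by omega) (by omega)⟩
  rcases hH (f (n - 1)) (f 0) (f (n - 2)) (f 1) (f (n - 3)) (mem _ (by omega)) (mem _ (by omega))
    (mem _ (by omega)) ((h.adj' (by omega) (by omega)).2 (by omega))
    ((h.adj' (by omega) (by omega)).2 (by omega)) ((h.adj' (by omega) (by omega)).2 (by omega))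
    ((h.adj' (by omega) (by omega)).2 (by omega)) (path _ (by omega) (by omega)) with h' | h'
  · exact h.inj 0 (n - 2) (by omega) (by omega) h'
  · rw [h.adj' (by omega) (by omega)] at h'
    omega

theorem tri_free (h : IsHole G n f) {a b c : V} (ha : On n f a) (hb : On n f b) (hc : On n f c)
    (hab : G.Adj a b) (hac : G.Adj a c) (hbc : G.Adj b c) : False := by
  obtain ⟨i, hi, rfl⟩ := ha
  obtain ⟨j, hj, rfl⟩ := hb
  obtain ⟨k, hk, rfl⟩ := hc
  rw [h.adj' (by omega) (by omega)] at hab hac hbc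
  have := h.four
  omega

theorem other (h : IsHole G n f) {u w : V} (hu : On n f u) (hw : On n f w) (huw : G.Adj u w) :
    ∃ g, On n f g ∧ G.Adj g u ∧ g ≠ w ∧ ¬ G.Adj g w := by
  have h4 := h.four
  obtain ⟨i, hi, rfl⟩ := hu
  have key : ∃ j < n, f j ≠ w ∧ G.Adj (f j) (f i) := by
    have h1 : ∃ j k, j < n ∧ k < n ∧ j ≠ k ∧ G.Adj (f j) (f i) ∧ G.Adj (f k) (f i) := by
      by_cases hi0 : i = 0
      · exact ⟨1, n - 1, by omega, by omega, by omega, (h.adj' (by omega) (by omega)).2 (by omega),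
          (h.adj' (by omega) (by omega)).2 (by omega)⟩
      by_cases hin : i = n - 1
      · exact ⟨0, n - 2, by omega, by omega, by omega, (h.adj' (by omega) (by omega)).2 (by omega),
          (h.adj' (by omega) (by omega)).2 (by omega)⟩
      · exact ⟨i + 1, i - 1, by omega, by omega, by omega, (h.adj' (by omega) (by omega)).2 (by omega),
          (h.adj' (by omega) (by omega)).2 (by omega)⟩
    obtain ⟨j, k, hj, hk, hjk, h1, h2⟩ := h1
    by_cases e : f j = w
    · refine ⟨k, hk, fun e' => hjk (h.inj' hj hk (e.trans e'.symm)), h2⟩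
    · exact ⟨j, hj, e, h1⟩
  obtain ⟨j, hj, h1, h2⟩ := key
  exact ⟨f j, ⟨j, hj, rfl⟩, h2, h1, fun h3 => h.tri_free ⟨j, hj, rfl⟩ ⟨i, hi, rfl⟩ hw h2 h3 huw⟩

theorem wheel (h : IsHole G n f) {w : V} (hw : ∀ i < n, G.Adj w (f i)) : Nonempty (wheel n ↪g G) := by
  have h4 := h.four
  refine emb_mk (Sum.elim (fun i => f i) (fun _ => w)) ?_
  rintro (i | i) (j | j) hne
  · have hij : (i : ℕ) ≠ j := fun e => hne (by rw [Fin.ext e])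
    have e : (_root_.wheel n).Adj (Sum.inl i) (Sum.inl j) ↔ G.Adj (f i) (f j) := by
      rw [h.adj' i.2 j.2]
      rw [wheel_inl, succ_mod, succ_mod]
      constructor
      · rintro ⟨_, h⟩; omega
      · intro h; exact ⟨fun e => hij (by rw [e]), by omega⟩
    by_cases hA : G.Adj (f i) (f j)
    · exact Or.inl ⟨e.2 hA, hA⟩
    · exact Or.inr ⟨fun h' => hA (e.1 h'), fun e' => hij (h.inj' j.2 i.2 e').symm, fun h' => hA h'.symm⟩
  · left
    refine ⟨?_, (hw i i.2).symm⟩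
    simp [_root_.wheel, SimpleGraph.fromRel_adj]
  · left
    refine ⟨?_, hw j j.2⟩
    simp [_root_.wheel, SimpleGraph.fromRel_adj]
  · exact absurd rfl hne

end IsHole
end Hole

section Main
variable {V : Type} [Fintype V] {G : SimpleGraph V} {M : CAModel V} {a b c : V} {n : ℕ} {f : ℕ → V}
open IsHole

theorem hole_covers (hG : M.IsModelOf G) (h : IsHole G n f) (q : Circ) : ∃ v, On n f v ∧ q ∈ pt M v := by
  by_contra hc
  push Not at hc
  exact h.not_hch (hch_uncovered hG hc)

theorem sub_false (hG : M.IsModelOf G) (h : IsHole G n f) {u w : V} (hu : On n f u) (hw : On n f w)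
    (huw : u ≠ w) (hs : ∀ p ∈ pt M u, p ∈ pt M w) : False := by
  obtain ⟨x, hx⟩ := pt_nonempty M u
  obtain ⟨g, _, h1, h2, h3⟩ := h.other hu hw (adj_of_mem hG huw hx (hs x hx))
  obtain ⟨y, hy1, hy2⟩ := (model_adj hG h1.ne).1 h1
  exact h3 (adj_of_mem hG h2 hy1 (hs y hy2))

theorem lemT (hG : M.IsModelOf G) (hM : M.Normal) (hW : ∀ w, HchOn G (G.Adj w)) (h : IsHole G n f)
    (hc : Cov M a b c) (hab : a ≠ b) (hac : a ≠ c) (hbc : b ≠ c) (ha : ¬ On n f a) :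
    ∃ t, On n f t ∧ (∃ x ∈ pt M t, x ∉ pt M b ∧ x ∉ pt M c) ∧ G.Adj t a ∧ G.Adj t b ∧ G.Adj t c := by
  let U : V → Prop := fun z => On n f z ∧ ∃ x ∈ pt M z, x ∉ pt M b ∧ x ∉ pt M c
  have hU : ∀ z, U z → G.Adj a z := by
    rintro z ⟨hz, x, hx, hx1, hx2⟩
    refine adj_of_mem hG (fun e => ha (e ▸ hz)) ?_ hx
    have := hc.mem x
    tauto
  have nb : ¬ U b := by rintro ⟨_, x, hx, hx1, _⟩; exact hx1 hx
  have nc : ¬ U c := by rintro ⟨_, x, hx, _, hx1⟩; exact hx1 hx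
  have neb : ∀ z, U z → z ≠ b := fun z hz e => nb (e ▸ hz)
  have nec : ∀ z, U z → z ≠ c := fun z hz e => nc (e ▸ hz)
  let U1 : V → Prop := fun z => ∃ w, G.Adj b w ∧ Cn G U w z
  have key : ∃ z, U1 z ∧ G.Adj c z := by
    by_contra hno
    push Not at hno
    have hcon : IsPreconnected (pt M a) := pts_preconn _
    obtain ⟨p, _, hp1, hp2⟩ := hcon (pt M b ∪ ⋃ z ∈ {z | U1 z}, pt M z)
      (pt M c ∪ ⋃ z ∈ {z | U z ∧ ¬ U1 z}, pt M z)
      ((pts_open _).union (isOpen_biUnion fun z _ => pts_open _))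
      ((pts_open _).union (isOpen_biUnion fun z _ => pts_open _))
      (by
        intro x hx
        by_cases hxb : x ∈ pt M b
        · exact Or.inl (Or.inl hxb)
        by_cases hxc : x ∈ pt M c
        · exact Or.inr (Or.inl hxc)
        obtain ⟨z, hz, hxz⟩ := hole_covers hG h x
        have hUz : U z := ⟨hz, x, hxz, hxb, hxc⟩
        by_cases h1 : U1 z
        · exact Or.inl (Or.inr (mem_biUnion (show z ∈ {z | U1 z} from h1) hxz))
        · exact Or.inr (Or.inr (mem_biUnion (show z ∈ {z | U z ∧ ¬ U1 z} from ⟨hUz, h1⟩) hxz)))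
      (by
        obtain ⟨x, hx, hx'⟩ := hc.meet hM hac hbc
        exact ⟨x, hx, Or.inl hx'⟩)
      (by
        obtain ⟨x, hx, hx'⟩ := hc.rot.rot.meet hM hbc.symm hab
        exact ⟨x, hx', Or.inl hx⟩)
    have pa : p ∈ pt M a := by assumption
    rcases hp1 with hp1 | hp1
    · rcases hp2 with hp2 | hp2
      · exact hc.no_common hM hab hac hbc pa hp1 hp2
      · simp only [mem_iUnion, mem_ofPred_eq] at hp2
        obtain ⟨z, ⟨hz, hz1⟩, hpz⟩ := hp2
        exact hz1 ⟨z, adj_of_mem hG (neb z hz).symm hp1 hpz, .refl hz⟩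
    · simp only [mem_iUnion, mem_ofPred_eq] at hp1
      obtain ⟨z, hz, hpz⟩ := hp1
      have hUz : U z := by obtain ⟨w, _, hw⟩ := hz; exact hw.right
      rcases hp2 with hp2 | hp2
      · exact hno z hz (adj_of_mem hG (nec z hUz).symm hp2 hpz)
      · simp only [mem_iUnion, mem_ofPred_eq] at hp2
        obtain ⟨z', ⟨hz', hz1'⟩, hpz'⟩ := hp2
        obtain ⟨w, hw, hw'⟩ := id hz
        have : z ≠ z' := fun e => hz1' (e ▸ hz)
        exact hz1' ⟨w, hw, hw'.tail (adj_of_mem hG this hpz hpz') hz'⟩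
  obtain ⟨z, ⟨w, hw, hC⟩, hz⟩ := key
  have hadj_ab := hc.adj hG hM hab hac hbc
  have hadj_bc := hc.rot.adj hG hM hbc hab.symm hac.symm
  have hadj_ca := hc.rot.rot.adj hG hM hac.symm hbc.symm hab
  obtain ⟨t, ht, h1, h2⟩ := tri (hW a) hadj_bc hw hz hU hadj_ab hadj_ca.symm nb nc hC
  exact ⟨t, ht.1, ht.2, (hU t ht).symm, h1, h2⟩

theorem two_in (hG : M.IsModelOf G) (hM : M.Normal) (hd : ∀ w, ∃ g, On n f g ∧ ¬ G.Adj w g)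
    (h : IsHole G n f) (hc : Cov M a b c) (hab : a ≠ b) (hac : a ≠ c) (hbc : b ≠ c)
    (ha : On n f a) (hb : On n f b) : False := by
  have hadj_ab := hc.adj hG hM hab hac hbc
  have hadj_bc := hc.rot.adj hG hM hbc hab.symm hac.symm
  have hadj_ca := hc.rot.rot.adj hG hM hac.symm hbc.symm hab
  by_cases hcH : On n f c
  · exact h.tri_free ha hb hcH hadj_ab hadj_ca.symm hadj_bc
  obtain ⟨g, hg, hgc⟩ := hd c
  have ga : g ≠ a := by rintro rfl; exact hgc hadj_ca
  have gb : g ≠ b := by rintro rfl; exact hgc hadj_bc.symm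
  have gc : g ≠ c := by rintro rfl; exact hcH hg
  have hgc' : ∀ x ∈ pt M g, x ∉ pt M c := fun x hx hx' => hgc (adj_of_mem hG gc.symm hx' hx)
  by_cases g1 : G.Adj g a
  · by_cases g2 : G.Adj g b
    · exact h.tri_free hg ha hb g1 g2 hadj_ab
    · refine sub_false hG h hg ha ga fun x hx => ?_
      have := hc.mem x
      have := hgc' x hx
      have : x ∉ pt M b := fun hx' => g2 (adj_of_mem hG gb hx hx')
      tauto
  · refine sub_false hG h hg hb gb fun x hx => ?_
    have := hc.mem x
    have := hgc' x hx
    have : x ∉ pt M a := fun hx' => g1 (adj_of_mem hG ga hx hx')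
    tauto

theorem one_in (hG : M.IsModelOf G) (hM : M.Normal) (hW : ∀ w, HchOn G (G.Adj w))
    (hd : ∀ w, ∃ g, On n f g ∧ ¬ G.Adj w g)
    (h : IsHole G n f) (hc : Cov M a b c) (hab : a ≠ b) (hac : a ≠ c) (hbc : b ≠ c)
    (ha : On n f a) : False := by
  have hb : ¬ On n f b := fun hb => two_in hG hM hd h hc hab hac hbc ha hb
  have hcH : ¬ On n f c := fun hc' => two_in hG hM hd h hc.rot.rot hac.symm hbc.symm hab hc' ha
  obtain ⟨t, ht, htx, hta, htb, htc⟩ : ∃ t, On n f t ∧ (∃ x ∈ pt M t, x ∉ pt M a ∧ x ∉ pt M c) ∧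
    G.Adj t b ∧ G.Adj t a ∧ G.Adj t c := lemT hG hM hW h hc.swap hab.symm hbc hac hb
  obtain ⟨s, hs, hsx, hsc, hsa, hsb⟩ := lemT hG hM hW h hc.rot.rot hac.symm hbc.symm hab hcH
  have n1 : ∀ t, On n f t → t ≠ a → ¬ Cov M a t c := by
    intro t ht hta hcov
    exact two_in hG hM hd h hcov hta.symm hac (fun e => hcH (e ▸ ht)) ha ht
  have n2 : ∀ t, On n f t → t ≠ a → ¬ Cov M a b t := by
    intro t ht hta hcov
    exact two_in hG hM hd h hcov.rot.rot hta (fun e => hb (e ▸ ht)) hab ht ha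
  have cv : ∀ t, On n f t → G.Adj t a → G.Adj t b → G.Adj t c → Cov M t b c := by
    intro t ht h1 h2 h3
    rcases hc.tc2 ((model_adj hG h1.ne).1 h1) ((model_adj hG h2.ne).1 h2) ((model_adj hG h3.ne).1 h3)
      with h' | h' | h'
    · exact h'
    · exact absurd h' (n1 t ht h1.ne)
    · exact absurd h' (n2 t ht h1.ne)
  have ct := cv t ht htb hta htc
  have cs := cv s hs hsa hsb hsc
  have e : t = s := by
    by_contra hne
    obtain ⟨x, hx1, hx2, hx3⟩ := ct.excl hM hbc
    have : x ∈ pt M s := by have := cs.mem x; tauto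
    exact h.tri_free ht hs ha (adj_of_mem hG hne hx1 this) htb hsa
  subst e
  exact sub_false hG h ha ht htb.ne'
    (hc.tc3 hM hbc ct (n1 t ht htb.ne) (n2 t ht htb.ne) htx hsx)

theorem hch_of_cov (hG : M.IsModelOf G) (hM : M.Normal) (hwh : ∀ n, 4 ≤ n → IsEmpty (wheel n ↪g G))
    (hc : Cov M a b c) (hab : a ≠ b) (hac : a ≠ c) (hbc : b ≠ c) : Hch G := by
  have nowheel : ∀ {n f}, IsHole G n f → ∀ w, ¬ ∀ i < n, G.Adj w (f i) := by
    intro n f h w hw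
    obtain ⟨e⟩ := h.wheel hw
    exact (hwh n h.four).false e
  have hW : ∀ w, HchOn G (G.Adj w) := by
    intro w
    by_contra hc
    obtain ⟨n, f, h, hf⟩ := exists_hole hc
    exact nowheel h w hf
  by_contra hH
  obtain ⟨n, f, h, -⟩ := exists_hole hH
  have hd : ∀ w, ∃ g, On n f g ∧ ¬ G.Adj w g := by
    intro w
    by_contra hc
    push Not at hc
    exact nowheel h w fun i hi => hc _ ⟨i, hi, rfl⟩
  by_cases ha : On n f a
  · exact one_in hG hM hW hd h hc hab hac hbc ha
  by_cases hb : On n f b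
  · exact one_in hG hM hW hd h hc.rot hbc hab.symm hac.symm hb
  by_cases hcH : On n f c
  · exact one_in hG hM hW hd h hc.rot.rot hac.symm hbc.symm hab hcH
  obtain ⟨t, ht, -, h1, h2, h3⟩ := lemT hG hM hW h hc hab hac hbc ha
  rcases hc.tc2 ((model_adj hG h1.ne).1 h1) ((model_adj hG h2.ne).1 h2) ((model_adj hG h3.ne).1 h3)
    with h' | h' | h'
  · exact one_in hG hM hW hd h h' h2.ne h3.ne hbc ht
  · exact one_in hG hM hW hd h h'.swap h1.ne h3.ne hac ht
  · exact one_in hG hM hW hd h h'.rot.rot h1.ne h2.ne hab ht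

theorem backward (hG : IsNCAGraph G) (hwh : ∀ n, 4 ≤ n → IsEmpty (wheel n ↪g G)) (hB : ¬ Bad G) :
    IsNHCAGraph G := by
  obtain ⟨M, hM, hG⟩ := hG
  by_cases hH : M.Helly
  · exact ⟨M, hM, hH, hG⟩
  obtain ⟨a, b, c, hab, hac, hbc, hc⟩ := exists_cov hM hH
  have hch := hch_of_cov hG hM hwh hc hab hac hbc
  obtain ⟨f, hf, ho⟩ := ordering hch fun a b c h => hB (AT_bad hch (star_free hG) h)
  exact model_of_ordering f hf ho

end Main
end NH

namespace NH

section Fwd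
variable {V : Type} [Fintype V] {G : SimpleGraph V} {M : CAModel V}

theorem nhca_comap {W : Type} [Fintype W] {H : SimpleGraph W} (e : H ↪g G) (h : IsNHCAGraph G) :
    IsNHCAGraph H := by
  obtain ⟨M, hN, hH, hG⟩ := h
  refine ⟨⟨fun w => M.arc (e w), ?_⟩, ?_, ?_, ?_⟩
  · rintro ⟨u, b⟩ ⟨v, c⟩ h
    have := @M.endpoints_distinct (e u, b) (e v, c) h
    simp only [Prod.mk.injEq, EmbeddingLike.apply_eq_iff_eq] at this ⊢
    exact this
  · intro u v huv
    exact hN (e u) (e v) (fun h => huv (e.injective h))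
  · intro S hS
    obtain ⟨p, hp⟩ := hH (e '' S) (by
      rintro _ ⟨u, hu, rfl⟩ _ ⟨v, hv, rfl⟩
      exact hS u hu v hv)
    exact ⟨p, fun v hv => hp (e v) ⟨v, hv, rfl⟩⟩
  · intro u v
    rw [← e.map_adj_iff, hG (e u) (e v)]
    exact and_congr e.injective.ne_iff Iff.rfl

def Cvr (M : CAModel V) (W : V → Prop) : Prop := ∀ q, ∃ v, W v ∧ q ∈ pt M v

theorem helly3 (hG : M.IsModelOf G) (hH : M.Helly) {a b c : V} (hab : a = b ∨ G.Adj a b)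
    (hac : a = c ∨ G.Adj a c) (hbc : b = c ∨ G.Adj b c) : ∃ p, p ∈ pt M a ∧ p ∈ pt M b ∧ p ∈ pt M c := by
  have self : ∀ v, M.Inter v v := fun v => by
    obtain ⟨x, hx⟩ := pt_nonempty M v
    exact ⟨x, hx, hx⟩
  have key : ∀ u v, (u = v ∨ G.Adj u v) → M.Inter u v ∧ M.Inter v u := by
    rintro u v (rfl | h)
    · exact ⟨self u, self u⟩
    · exact ⟨((hG u v).1 h).2, ((hG v u).1 h.symm).2⟩
  obtain ⟨p, hp⟩ := hH {a, b, c} (by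
    have h1 := key a b hab
    have h2 := key a c hac
    have h3 := key b c hbc
    rintro u (rfl | rfl | rfl) v (rfl | rfl | rfl)
    all_goals first | exact self _ | exact h1.1 | exact h1.2 | exact h2.1 | exact h2.2 | exact h3.1 | exact h3.2)
  exact ⟨p, hp a (by simp), hp b (by simp), hp c (by simp)⟩

theorem elim_simplicial (hG : M.IsModelOf G) (hN : M.Normal) (hH : M.Helly) {W : V → Prop} (hC : Cvr M W)
    {v : V} (hs : ∀ u w, W u → W w → G.Adj u v → G.Adj w v → u = w ∨ G.Adj u w) :
    Cvr M (fun z => W z ∧ z ≠ v) := by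
  intro q
  by_contra hc
  push Not at hc
  have hq : ∀ u, W u → u ≠ v → q ∉ pt M u := fun u hu h h' => hc u ⟨hu, h⟩ h'
  have hqv : q ∈ pt M v := by
    obtain ⟨u, hu, hu'⟩ := hC q
    by_cases e : u = v
    · exact e ▸ hu'
    · exact absurd hu' (hq u hu e)
  have hst : 0 < ph q (M.arc v).t ∧ ph q (M.arc v).t < ph q (M.arc v).s := by
    have := (mem_pts q q (M.arc v)).1 hqv
    rw [ph_self] at this
    have := ph_nonneg q (M.arc v).s
    rcases ‹_ ∨ _› with h | h | h
    · linarith [h.1]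
    · exact h
    · linarith [h.2]
  have mem : ∀ x, x ∈ pt M v ↔ ph q x < ph q (M.arc v).t ∨ ph q (M.arc v).s < ph q x := by
    intro x
    unfold pt
    rw [mem_pts q]
    constructor
    · rintro (h | h | h)
      · linarith [h.1, h.2]
      · exact Or.inl h.1
      · exact Or.inr h.2
    · rintro (h | h)
      · exact Or.inr (Or.inl ⟨h, hst.2⟩)
      · exact Or.inr (Or.inr ⟨hst.2, h⟩)
  obtain ⟨u1, hu1, hs1⟩ := hC (M.arc v).s
  obtain ⟨u2, hu2, ht2⟩ := hC (M.arc v).t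
  have n1 : u1 ≠ v := by rintro rfl; exact s_not_mem _ hs1
  have n2 : u2 ≠ v := by rintro rfl; exact t_not_mem _ ht2
  have q1 := hq u1 hu1 n1
  have q2 := hq u2 hu2 n2
  have a1 : G.Adj u1 v := by
    have h1 := (mem_pts_of_not q1 _).1 hs1
    obtain ⟨y, hy1, hy2, hy3⟩ : ∃ y, ph q (M.arc v).s < y ∧ y < 1 ∧
        (y < ph q (M.arc u1).t ∨ (M.arc u1).t = q) := by
      rcases h1.1.2 with h | h
      · obtain ⟨y, h1, h2⟩ := exists_between h
        exact ⟨y, h1, h2.trans (ph_lt _ _), Or.inl h2⟩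
      · obtain ⟨y, h1, h2⟩ := exists_between (ph_lt q (M.arc v).s)
        exact ⟨y, h1, h2, Or.inr h⟩
    have hy : ph q (q + (y : Circ)) = y := ph_of (by linarith) hy2
    refine adj_of_mem hG n1 (x := q + (y : Circ)) ?_ ?_
    · exact (mem_pts_of_not q1 _).2 (by rw [hy]; exact ⟨⟨by linarith [h1.1.1], hy3⟩, h1.2⟩)
    · rw [mem, hy]; exact Or.inr hy1
  have a2 : G.Adj u2 v := by
    have h1 := (mem_pts_of_not q2 _).1 ht2
    obtain ⟨y, hy1, hy2⟩ := exists_between h1.1.1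
    have hy : ph q (q + (y : Circ)) = y :=
      ph_of (by linarith [ph_nonneg q (M.arc u2).s]) (by linarith [ph_lt q (M.arc v).t])
    refine adj_of_mem hG n2 (x := q + (y : Circ)) ?_ ?_
    · refine (mem_pts_of_not q2 _).2 ?_
      rw [hy]
      refine ⟨⟨hy1, ?_⟩, h1.2⟩
      rcases h1.1.2 with h | h
      · left; linarith
      · exact Or.inr h
    · rw [mem, hy]; exact Or.inl hy2
  obtain ⟨z, hzv, hz1, hz2⟩ := helly3 hG hH (Or.inr a1.symm) (Or.inr a2.symm) (hs u1 u2 hu1 hu2 a1 a2)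
  rw [mem] at hzv
  rcases hzv with h | h
  · apply hN u1 v n1
    rw [eq_univ_iff_forall]
    intro x
    by_cases hx : x ∈ pt M v
    · exact Or.inr hx
    · rw [mem] at hx
      push Not at hx
      exact Or.inl (convex_of_not q1 hz1 hs1 (by linarith [hx.1]) hx.2)
  · apply hN u2 v n2
    rw [eq_univ_iff_forall]
    intro x
    by_cases hx : x ∈ pt M v
    · exact Or.inr hx
    · rw [mem] at hx
      push Not at hx
      exact Or.inl (convex_of_not q2 ht2 hz2 hx.1 (by linarith [hx.2]))

theorem not_nhca (r : V → ℕ) (hr : Function.Injective r)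
    (hs : ∀ v u w, r v < r u → r v < r w → G.Adj u v → G.Adj w v → u = w ∨ G.Adj u w)
    {a b c : V} (hAT : IsAT G a b c) : ¬ IsNHCAGraph G := by
  rintro ⟨M, hN, hH, hG⟩
  have cov : Cvr M (fun _ => True) := by
    intro q
    by_contra hc
    push Not at hc
    exact AT_uncovered hG (fun v => hc v trivial) a b c hAT
  have step : ∀ k, Cvr M (fun z => k ≤ r z) := by
    intro k
    induction k with
    | zero => simpa using cov
    | succ k ih =>
      by_cases hk : ∃ v, r v = k
      · obtain ⟨v, hv⟩ := hk
        have := elim_simplicial hG hN hH ih (v := v) (by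
          intro u w hu hw huv hwv
          have e1 : r u ≠ r v := fun e => huv.ne (hr e)
          have e2 : r w ≠ r v := fun e => hwv.ne (hr e)
          exact hs v u w (by omega) (by omega) huv hwv)
        intro q
        obtain ⟨u, ⟨h1, h2⟩, h3⟩ := this q
        have e1 : r u ≠ r v := fun e => h2 (hr e)
        exact ⟨u, by omega, h3⟩
      · intro q
        obtain ⟨u, h1, h2⟩ := ih q
        have : r u ≠ k := fun e => hk ⟨u, e⟩
        exact ⟨u, by omega, h2⟩
  obtain ⟨v, hv, _⟩ := step (Finset.univ.sup r + 1) 0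
  have := Finset.le_sup (f := r) (Finset.mem_univ v)
  omega

theorem wheel_not {n : ℕ} (hn : 4 ≤ n) : ¬ IsNHCAGraph (wheel n) := by
  rintro ⟨M, hN, hH, hG⟩
  let u : Fin n ⊕ Unit := Sum.inr ()
  let f : ℕ → Fin n ⊕ Unit := fun i => if h : i < n then Sum.inl ⟨i, h⟩ else u
  have fe : ∀ i (h : i < n), f i = Sum.inl ⟨i, h⟩ := fun i h => by simp [f, h]
  have hole : IsHole (wheel n) n f := by
    refine ⟨hn, ?_, ?_⟩
    · intro i j hij hj
      rw [fe i (by omega), fe j hj]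
      intro e
      have := Sum.inl_injective e
      rw [Fin.mk.injEq] at this
      omega
    · intro i j hij hj
      rw [fe i (by omega), fe j hj, wheel_inl, succ_mod, succ_mod]
      simp only [ne_eq, Fin.mk.injEq]
      omega
  have hub : ∀ v, IsHole.On n f v → (wheel n).Adj v u := by
    rintro v ⟨i, hi, rfl⟩
    rw [fe i hi]
    unfold wheel
    rw [SimpleGraph.fromRel_adj]
    exact ⟨by simp [u], Or.inr (Or.inl ⟨(), rfl⟩)⟩
  refine hole.not_hch (interval_hch (fun v => ph (M.arc u).s '' (pt M v ∩ pt M u))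
    (fun v _ => trace_ord hN (s_not_mem _)) ?_ ?_)
  · intro v w hv hw hvw
    rw [inter_image]
    constructor
    · intro h
      obtain ⟨p, h1, h2, h3⟩ := helly3 hG hH (Or.inr h) (Or.inr (hub v hv)) (Or.inr (hub w hw))
      exact ⟨p, ⟨h1, h3⟩, ⟨h2, h3⟩⟩
    · rintro ⟨p, h1, h2⟩
      exact adj_of_mem hG hvw h1.1 h2.1
  · intro v hv
    exact ((model_adj hG (hub v hv).ne).1 (hub v hv)).image _

instance : DecidableRel sun3.Adj := fun _ _ => decidable_of_iff _ (SimpleGraph.fromRel_adj _ _ _).symm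
instance : DecidableRel umbrella.Adj := fun _ _ => decidable_of_iff _ (SimpleGraph.fromRel_adj _ _ _).symm
instance : DecidableRel tent.Adj := fun u v =>
  decidable_of_iff (u ≠ v ∧ ¬ sun3.Adj u v) (SimpleGraph.compl_adj sun3 u v).symm
instance decAv {W : Type} [DecidableEq W] (H : SimpleGraph W) [DecidableRel H.Adj] (a b : W) :
    Decidable (av H a b) := inferInstanceAs (Decidable (_ ∧ _))

theorem cn_one {W : Type} {H : SimpleGraph W} {P : W → Prop} {a b c : W} (h1 : H.Adj a b) (h2 : H.Adj b c)
    (ha : P a) (hb : P b) (hc : P c) : Cn H P a c := .head h1 ha (.head h2 hb (.refl hc))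

theorem sun3_not : ¬ IsNHCAGraph sun3 := by
  refine not_nhca (a := 3) (b := 4) (c := 5) (fun v => ((v : ℕ) + 3) % 6) ?_ ?_ ⟨?_, ?_, ?_⟩
  · intro u v; revert u v; decide
  · decide
  · exact cn_one (b := 1) (by decide) (by decide) (by decide) (by decide) (by decide)
  · exact cn_one (b := 2) (by decide) (by decide) (by decide) (by decide) (by decide)
  · exact cn_one (b := 0) (by decide) (by decide) (by decide) (by decide) (by decide)

theorem tent_not : ¬ IsNHCAGraph tent := by
  refine not_nhca (a := 0) (b := 1) (c := 2) (fun v => (v : ℕ)) Fin.val_injective ?_ ⟨?_, ?_, ?_⟩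
  · decide
  · exact .head (b := 4) (by decide) (by decide)
      (cn_one (b := 5) (by decide) (by decide) (by decide) (by decide) (by decide))
  · exact .head (b := 5) (by decide) (by decide)
      (cn_one (b := 3) (by decide) (by decide) (by decide) (by decide) (by decide))
  · exact .head (b := 3) (by decide) (by decide)
      (cn_one (b := 4) (by decide) (by decide) (by decide) (by decide) (by decide))

theorem umbrella_not : ¬ IsNHCAGraph umbrella := by
  refine not_nhca (a := 0) (b := 4) (c := 6) (fun v => ((v : ℕ) + 1) % 7) ?_ ?_ ⟨?_, ?_, ?_⟩
  · intro u v; revert u v; decide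
  · decide
  · exact cn_one (b := 5) (by decide) (by decide) (by decide) (by decide) (by decide)
  · exact .head (b := 3) (by decide) (by decide)
      (cn_one (b := 2) (by decide) (by decide) (by decide) (by decide) (by decide))
  · exact .head (b := 2) (by decide) (by decide)
      (cn_one (b := 1) (by decide) (by decide) (by decide) (by decide) (by decide))

theorem rs_ll {n : ℕ} (a b : Fin n) : (risingSun n).Adj (Sum.inl a) (Sum.inl b) ↔ (a : ℕ) ≠ b ∧
    ((a : ℕ) = 0 ∨ (a : ℕ) = n - 1 ∨ (b : ℕ) = a + 1 ∨ (b : ℕ) = 0 ∨ (b : ℕ) = n - 1 ∨ (a : ℕ) = b + 1) := by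
  unfold risingSun
  rw [SimpleGraph.fromRel_adj]
  simp only [ne_eq, Sum.inl.injEq, Fin.ext_iff]
  tauto

theorem rs_rl {n : ℕ} (w : Fin 3) (a : Fin n) : (risingSun n).Adj (Sum.inr w) (Sum.inl a) ↔
    ((w : ℕ) = 0 ∧ ((a : ℕ) = 0 ∨ (a : ℕ) = 1)) ∨
        ((w : ℕ) = 1 ∧ ((a : ℕ) = n - 2 ∨ (a : ℕ) = n - 1)) ∨
        ((w : ℕ) = 2 ∧ ((a : ℕ) = n - 1 ∨ (a : ℕ) = 0)) := by
  unfold risingSun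
  rw [SimpleGraph.fromRel_adj]
  simp

theorem rs_rr {n : ℕ} (w w' : Fin 3) : ¬ (risingSun n).Adj (Sum.inr w) (Sum.inr w') := by
  unfold risingSun
  rw [SimpleGraph.fromRel_adj]
  simp

theorem rising_not {n : ℕ} (hn : 4 ≤ n) : ¬ IsNHCAGraph (risingSun n) := by
  have lv : ∀ (w : Fin 3) (a : Fin n), ¬ (((w : ℕ) = 0 ∧ ((a : ℕ) = 0 ∨ (a : ℕ) = 1)) ∨
        ((w : ℕ) = 1 ∧ ((a : ℕ) = n - 2 ∨ (a : ℕ) = n - 1)) ∨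
        ((w : ℕ) = 2 ∧ ((a : ℕ) = n - 1 ∨ (a : ℕ) = 0))) →
        av (risingSun n) (Sum.inr w) (Sum.inl a) := by
    intro w a h
    exact ⟨by simp, fun h' => h ((rs_rl w a).1 h'.symm)⟩
  have wv : ∀ (w w' : Fin 3), w ≠ w' → av (risingSun n) (Sum.inr w) (Sum.inr w') := by
    intro w w' h
    exact ⟨fun e => h (Sum.inr_injective e).symm, rs_rr _ _⟩
  refine not_nhca (a := Sum.inr 0) (b := Sum.inr 1) (c := Sum.inr 2)
    (Sum.elim (fun a => if (a : ℕ) = 0 then n + 1 else (a : ℕ) + 2 + (if (a : ℕ) = n - 1 then 1 else 0))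
      (fun w => (w : ℕ))) ?_ ?_ ⟨?_, ?_, ?_⟩
  · rintro (a | a) (b | b) h
    · simp only [Sum.elim_inl] at h
      congr 1; ext
      have := a.2
      have := b.2
      split_ifs at h <;> omega
    · simp only [Sum.elim_inl, Sum.elim_inr] at h
      have := b.2
      split_ifs at h <;> omega
    · simp only [Sum.elim_inl, Sum.elim_inr] at h
      have := a.2
      split_ifs at h <;> omega
    · simp only [Sum.elim_inr] at h
      congr 1; ext; exact h
  · rintro (v | v) (a | a) (b | b) h1 h2 h3 h4
    · have := a.2
      have := b.2
      have := v.2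
      rw [rs_ll] at h3 h4
      rw [rs_ll]
      simp only [Sum.elim_inl] at h1 h2
      by_cases e : a = b
      · left; rw [e]
      right
      have e : (a : ℕ) ≠ b := fun e' => e (Fin.ext e')
      refine ⟨e, ?_⟩
      split_ifs at h1 h2 <;> omega
    · simp only [Sum.elim_inl, Sum.elim_inr] at h2
      have := b.2
      split_ifs at h2 <;> omega
    · simp only [Sum.elim_inl, Sum.elim_inr] at h1
      have := a.2
      split_ifs at h1 <;> omega
    · simp only [Sum.elim_inl, Sum.elim_inr] at h1
      have := a.2
      split_ifs at h1 <;> omega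
    · have := v.2
      rw [SimpleGraph.adj_comm, rs_rl] at h3 h4
      rw [rs_ll]
      by_cases e : a = b
      · left; rw [e]
      right
      have e : (a : ℕ) ≠ b := fun e' => e (Fin.ext e')
      exact ⟨e, by omega⟩
    · exact absurd h4 (rs_rr _ _)
    · exact absurd h3 (rs_rr _ _)
    · exact absurd h3 (rs_rr _ _)
  · have path : ∀ j, 1 ≤ j → ∀ hj : j < n - 1,
        Cn (risingSun n) (av (risingSun n) (Sum.inr 2)) (Sum.inr 0) (Sum.inl ⟨j, by omega⟩) := by
      intro j h1
      induction j, h1 using Nat.le_induction with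
      | base =>
        intro hj
        exact .single ((rs_rl _ _).2 (by simp)) (wv _ _ (by decide)) (lv _ _ (by simp; omega))
      | succ j h1 ih =>
        intro hj
        exact (ih (by omega)).tail ((rs_ll _ _).2 (by simp)) (lv _ _ (by simp; omega))
    exact (path (n - 2) (by omega) (by omega)).tail ((rs_rl _ _).2 (by simp)).symm (wv _ _ (by decide))
  · exact cn_one (b := Sum.inl ⟨n - 1, by omega⟩) ((rs_rl _ _).2 (by simp)) ((rs_rl _ _).2 (by simp)).symm
      (wv _ _ (by decide)) (lv _ _ (by simp; omega)) (wv _ _ (by decide))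
  · exact cn_one (b := Sum.inl ⟨0, by omega⟩) ((rs_rl _ _).2 (by simp)) ((rs_rl _ _).2 (by simp)).symm
      (wv _ _ (by decide)) (lv _ _ (by simp; omega)) (wv _ _ (by decide))

end Fwd
end NH

/-- An NCA graph is an NHCA graph iff it contains no induced wheel `W_n`
(`n ≥ 4`), 3-sun, rising sun `R_n` (`n ≥ 4`), umbrella, or tent. -/
theorem stmt_7 {V : Type} [Fintype V] (G : SimpleGraph V) (hG : IsNCAGraph G) :
    IsNHCAGraph G ↔
      ((∀ n : ℕ, 4 ≤ n → IsEmpty (wheel n ↪g G)) ∧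
       IsEmpty (sun3 ↪g G) ∧
       (∀ n : ℕ, 4 ≤ n → IsEmpty (risingSun n ↪g G)) ∧
       IsEmpty (umbrella ↪g G) ∧
       IsEmpty (tent ↪g G)) := by
  constructor
  · intro h
    exact ⟨fun n hn => ⟨fun e => NH.wheel_not hn (NH.nhca_comap e h)⟩,
      ⟨fun e => NH.sun3_not (NH.nhca_comap e h)⟩,
      fun n hn => ⟨fun e => NH.rising_not hn (NH.nhca_comap e h)⟩,
      ⟨fun e => NH.umbrella_not (NH.nhca_comap e h)⟩,
      ⟨fun e => NH.tent_not (NH.nhca_comap e h)⟩⟩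
  · rintro ⟨hw, hs, hr, hu, ht⟩
    refine NH.backward hG hw ?_
    rintro (⟨⟨e⟩⟩ | ⟨n, hn, ⟨e⟩⟩ | ⟨⟨e⟩⟩ | ⟨⟨e⟩⟩)
    · exact hs.false e
    · exact (hr n hn).false e
    · exact hu.false e
    · exact ht.false e
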